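/- Let P be a homogeneous simplicial d-complex with integer vertices in ℝ^d, let w be a nonnegative integer and let f ∈ C^{w+1}(ℝ^d). Let (c_j)_{0≤j≤⌊w/2⌋} be the unique solution of the Vandermonde linear system Σ_{j=0}^{⌊w/2⌋} (2^{−2k})^j c_j = δ_{k,0} for k = 0,1,…,⌊w/2⌋ (i.e. Σ_j c_j = 1 and Σ_j 2^{−2kj} c_j = 0 for 1 ≤ k ≤ ⌊w/2⌋). Then there exists a constant C (depending on f, P and w) such that for every positive integer N, | ∫_P f(x) dx − Σ_{0≤j≤⌊w/2⌋} c_j S_{2^j N}(f,P) | ≤ C N^{−w−1}. -/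

import Mathlib

open scoped Real Topology
open MeasureTheory Filter

/-- The Euclidean unit ball `{ y : |y| ≤ 1 }` in `ℝ^d`. -/
def eball (d : ℕ) : Set (Fin d → ℝ) := {y | ∑ i, (y i) ^ 2 ≤ 1}

/-- The normalized solid angle `ω_P(x)`, defined as the limit of the relative measures of
`P` in small balls centred at `x`. -/
noncomputable def solidAngle (d : ℕ) (P : Set (Fin d → ℝ)) (x : Fin d → ℝ) : ℝ :=
  limUnder (𝓝[>] (0 : ℝ))
    (fun ε : ℝ => (volume (eball d)).toReal⁻¹ *
      ∫ y in eball d, P.indicator (fun _ => (1 : ℝ)) (x - ε • y))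

/-- The weighted Riemann sum `S_N(f,P) = N^{-d} Σ_{n∈ℤ^d} ω_P(n/N) f(n/N)`. -/
noncomputable def SN (d : ℕ) (N : ℕ) (f : (Fin d → ℝ) → ℝ) (P : Set (Fin d → ℝ)) : ℝ :=
  (N : ℝ) ^ (-(d : ℤ)) *
    ∑' n : Fin d → ℤ,
      solidAngle d P (fun i => (n i : ℝ) / N) * f (fun i => (n i : ℝ) / N)

section ShiftedSum

variable {ι : Type*} [Fintype ι]

/-- The normalized sum of `g` over the points `(m + b) / N`, `m ∈ {0, …, R N}^ι`. -/
noncomputable def shiftedSum (R N : ℕ) (g : (ι → ℝ) → ℝ) (b : ι → ℝ) : ℝ :=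
  ((N : ℝ) ^ Fintype.card ι)⁻¹ *
    haveI := Classical.decEq ι
    ∑ m ∈ Fintype.piFinset (fun _ : ι => Finset.range (R * N + 1)),
      g ((N : ℝ)⁻¹ • ((fun i => (m i : ℝ)) + b))

lemma continuous_shiftedSum (R N : ℕ) {g : (ι → ℝ) → ℝ} (hg : Continuous g) :
    Continuous (shiftedSum R N g) := by
  unfold shiftedSum
  fun_prop

lemma abs_shiftedSum_le (R : ℕ) {N : ℕ} (hN : 0 < N) {g : (ι → ℝ) → ℝ} {M : ℝ}
    (hM : ∀ x, |g x| ≤ M) (b : ι → ℝ) :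
    |shiftedSum R N g b| ≤ ((R : ℝ) + 1) ^ Fintype.card ι * M := by
  classical
  have hN' : (1 : ℝ) ≤ N := by exact_mod_cast hN
  have hM0 : 0 ≤ M := (abs_nonneg _).trans (hM 0)
  unfold shiftedSum
  rw [abs_mul, abs_of_nonneg (by positivity)]
  have h1 : |∑ m ∈ Fintype.piFinset (fun _ : ι => Finset.range (R * N + 1)),
      g ((N : ℝ)⁻¹ • ((fun i => (m i : ℝ)) + b))| ≤ ((R * N + 1 : ℕ) : ℝ) ^ Fintype.card ι * M := by
    refine (Finset.abs_sum_le_sum_abs _ _).trans ?_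
    refine (Finset.sum_le_card_nsmul _ _ M fun m _ => hM _).trans ?_
    simp [Fintype.card_piFinset]
  have h2 : ((R * N + 1 : ℕ) : ℝ) ≤ N * (R + 1) := by push_cast; nlinarith
  calc _ ≤ ((N : ℝ) ^ Fintype.card ι)⁻¹ * (((R * N + 1 : ℕ) : ℝ) ^ Fintype.card ι * M) := by
        gcongr
    _ ≤ ((N : ℝ) ^ Fintype.card ι)⁻¹ * ((N * (R + 1)) ^ Fintype.card ι * M) := by gcongr
    _ = _ := by
        rw [mul_pow]
        field_simp

lemma hasDerivAt_shiftedSum_line (R N : ℕ) {g : (ι → ℝ) → ℝ} (hg : ContDiff ℝ 1 g)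
    [DecidableEq ι] (t v : ι → ℝ) (s : ℝ) :
    HasDerivAt (fun s : ℝ => shiftedSum R N g (t + s • v))
      ((N : ℝ)⁻¹ * ∑ i, v i *
        shiftedSum R N (fun x => fderiv ℝ g x (Pi.single i 1)) (t + s • v)) s := by
  have hlin : ∀ L : (ι → ℝ) →L[ℝ] ℝ, L v = ∑ i, v i * L (Pi.single i 1) := by
    intro L
    conv_lhs => rw [pi_eq_sum_univ' v, map_sum]
    simp
  have hterm : ∀ m : ι → ℕ,
      HasDerivAt (fun s : ℝ => g ((N : ℝ)⁻¹ • ((fun i => (m i : ℝ)) + (t + s • v))))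
        ((N : ℝ)⁻¹ * ∑ i, v i *
          fderiv ℝ g ((N : ℝ)⁻¹ • ((fun i => (m i : ℝ)) + (t + s • v))) (Pi.single i 1)) s := by
    intro m
    have h1 : HasDerivAt (fun s : ℝ => (N : ℝ)⁻¹ • ((fun i => (m i : ℝ)) + (t + s • v)))
        ((N : ℝ)⁻¹ • v) s := by
      have := (((hasDerivAt_id s).smul_const v).const_add t).const_add (fun i => (m i : ℝ))
      simpa only [id, one_smul] using this.fun_const_smul (N : ℝ)⁻¹
    have h2 := ((hg.differentiable one_ne_zero)
      ((N : ℝ)⁻¹ • ((fun i => (m i : ℝ)) + (t + s • v)))).hasFDerivAt.comp_hasDerivAt s h1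
    refine h2.congr_deriv ?_
    symm
    rw [map_smul, smul_eq_mul]
    rw [hlin]
  unfold shiftedSum
  have h := (HasDerivAt.fun_sum fun m (_ : m ∈ @Fintype.piFinset ι (Classical.decEq ι) _ _
    (fun _ : ι => Finset.range (R * N + 1))) => hterm m).const_mul
      ((N : ℝ) ^ Fintype.card ι)⁻¹
  refine h.congr_deriv ?_
  symm
  rw [← Finset.mul_sum, Finset.sum_comm]
  simp_rw [Finset.mul_sum]
  refine Finset.sum_congr rfl fun i _ => Finset.sum_congr rfl fun m _ => ?_
  ring

lemma shiftedSum_sub_shiftedSum (R N : ℕ) {g : (ι → ℝ) → ℝ} (hg : ContDiff ℝ 1 g)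
    [DecidableEq ι] (t b : ι → ℝ) :
    shiftedSum R N g b - shiftedSum R N g t =
      (N : ℝ)⁻¹ * ∫ s in (0 : ℝ)..1, ∑ i, (b i - t i) *
        shiftedSum R N (fun x => fderiv ℝ g x (Pi.single i 1)) (t + s • (b - t)) := by
  have hc : ∀ i, Continuous (shiftedSum R N (fun x => fderiv ℝ g x (Pi.single i 1))) := fun i =>
    continuous_shiftedSum R N ((hg.continuous_fderiv one_ne_zero).clm_apply continuous_const)
  have h := intervalIntegral.integral_eq_sub_of_hasDerivAt (a := 0) (b := 1)
    (fun s _ => hasDerivAt_shiftedSum_line R N hg t (b - t) s)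
    (Continuous.intervalIntegrable (by fun_prop) _ _)
  simp only [intervalIntegral.integral_const_mul, zero_smul, one_smul, add_zero,
    add_sub_cancel] at h
  exact h.symm

lemma setIntegral_Icc_shiftedSum (R : ℕ) {N : ℕ} (hN : 0 < N) {g : (ι → ℝ) → ℝ}
    (hg : Continuous g) (hR : ∀ x, (R : ℝ) < ‖x‖ → g x = 0) :
    ∫ t in Set.Icc (0 : ι → ℝ) 1, shiftedSum R N g t = ∫ x in Set.Ici (0 : ι → ℝ), g x := by
  classical
  have hN' : (0 : ℝ) < N := by exact_mod_cast hN
  let cell : (ι → ℕ) → Set (ι → ℝ) := fun m =>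
    Set.pi Set.univ fun i => Set.Ico ((m i : ℝ) / N) ((m i + 1 : ℝ) / N)
  have hcell_meas : ∀ m, MeasurableSet (cell m) := fun m =>
    MeasurableSet.univ_pi fun i => measurableSet_Ico
  have hmem : ∀ m x, x ∈ cell m ↔ ∀ i, 0 ≤ N * x i ∧ ⌊(N : ℝ) * x i⌋₊ = m i := by
    intro m x
    simp only [cell, Set.mem_pi, Set.mem_univ, true_imp_iff, Set.mem_Ico]
    refine forall_congr' fun i => ?_
    rw [div_le_iff₀ hN', lt_div_iff₀ hN', mul_comm (x i)]
    constructor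
    · rintro ⟨h1, h2⟩
      have h0 : 0 ≤ (N : ℝ) * x i := (Nat.cast_nonneg _).trans h1
      exact ⟨h0, (Nat.floor_eq_iff h0).2 ⟨h1, h2⟩⟩
    · rintro ⟨h0, h1⟩
      exact (Nat.floor_eq_iff h0).1 h1
  have hint : ∀ m, IntegrableOn g (cell m) := fun m =>
    (hg.integrableOn_Icc (a := fun i => (m i : ℝ) / N) (b := fun i => (m i + 1 : ℝ) / N)).mono_set
      (by
        intro x hx
        simp only [cell, Set.mem_pi, Set.mem_univ, true_imp_iff, Set.mem_Ico] at hx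
        exact ⟨fun i => (hx i).1, fun i => (hx i).2.le⟩)
  have hone : ∀ m : ι → ℕ, ((N : ℝ) ^ Fintype.card ι)⁻¹ *
      ∫ t in Set.Icc (0 : ι → ℝ) 1, g ((N : ℝ)⁻¹ • ((fun i => (m i : ℝ)) + t)) =
      ∫ x in cell m, g x := by
    intro m
    have h0 : (∫ t in Set.Icc (0 : ι → ℝ) 1, g ((N : ℝ)⁻¹ • ((fun i => (m i : ℝ)) + t))) =
        ∫ t in Set.pi Set.univ fun _ : ι => Set.Ico (0 : ℝ) 1,
          g ((N : ℝ)⁻¹ • ((fun i => (m i : ℝ)) + t)) :=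
      setIntegral_congr_set (Measure.univ_pi_Ico_ae_eq_Icc (f := (0 : ι → ℝ)) (g := 1)).symm
    rw [h0, ← integral_indicator (hcell_meas m),
      ← integral_indicator (MeasurableSet.univ_pi fun i => measurableSet_Ico)]
    have h3 : (fun t => Set.indicator (Set.pi Set.univ fun _ : ι => Set.Ico (0 : ℝ) 1)
        (fun t => g ((N : ℝ)⁻¹ • ((fun i => (m i : ℝ)) + t))) t) = fun t =>
        (fun u => (cell m).indicator g ((N : ℝ)⁻¹ • u)) ((fun i => (m i : ℝ)) + t) := by
      funext t
      simp only [Set.indicator]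
      refine if_congr ?_ rfl rfl
      simp only [cell, Set.mem_pi, Set.mem_univ, true_imp_iff, Set.mem_Ico, Pi.smul_apply,
        Pi.add_apply, smul_eq_mul]
      refine forall_congr' fun i => ?_
      rw [inv_mul_eq_div, div_le_div_iff_of_pos_right hN', div_lt_div_iff_of_pos_right hN']
      constructor <;> rintro ⟨h1, h2⟩ <;> constructor <;> linarith
    rw [h3, integral_add_left_eq_self (fun u => (cell m).indicator g ((N : ℝ)⁻¹ • u)),
      Measure.integral_comp_smul]
    simp [abs_of_pos hN', hN'.ne']
  have hsum : ∫ t in Set.Icc (0 : ι → ℝ) 1, shiftedSum R N g t =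
      ∑ m ∈ Fintype.piFinset (fun _ : ι => Finset.range (R * N + 1)), ∫ x in cell m, g x := by
    unfold shiftedSum
    rw [integral_const_mul, integral_finsetSum, Finset.mul_sum]
    · simp_rw [hone]
    · intro m _
      exact Continuous.integrableOn_Icc (by fun_prop)
  rw [hsum, ← integral_biUnion_finset _ (fun m _ => hcell_meas m) _ (fun m _ => hint m)]
  · symm
    refine setIntegral_eq_of_subset_of_forall_sdiff_eq_zero measurableSet_Ici ?_ ?_
    · intro x hx
      simp only [Set.mem_iUnion] at hx
      obtain ⟨m, -, hx⟩ := hx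
      intro i
      exact nonneg_of_mul_nonneg_right ((hmem m x).1 hx i).1 hN'
    · rintro x ⟨hx0, hx⟩
      apply hR
      by_contra! hle
      apply hx
      simp only [Set.mem_iUnion]
      have h0 : ∀ i, 0 ≤ N * x i := fun i => mul_nonneg hN'.le (hx0 i)
      refine ⟨fun i => ⌊(N : ℝ) * x i⌋₊, ?_, (hmem _ x).2 fun i => ⟨h0 i, rfl⟩⟩
      simp only [Fintype.mem_piFinset, Finset.mem_range, Nat.lt_succ_iff]
      intro i
      refine Nat.floor_le_of_le ?_
      have : x i ≤ R := (le_abs_self _).trans ((norm_le_pi_norm x i).trans hle)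
      push_cast
      nlinarith
  · intro m _ m' _ hne
    refine Set.disjoint_left.2 fun x hx hx' => hne ?_
    funext i
    rw [← ((hmem m x).1 hx i).2, ((hmem m' x).1 hx' i).2]

/-- The mean value operator: integrals over the unit cube of the increments along segments
ending at `b` of a field with components `φ i`. -/
noncomputable def cubeAverage (φ : ι → (ι → ℝ) → ℝ) (b : ι → ℝ) : ℝ :=
  ∫ t in Set.Icc (0 : ι → ℝ) 1, ∫ s in (0 : ℝ)..1, ∑ i, (b i - t i) * φ i (t + s • (b - t))

lemma continuous_cubeAverage_inner {φ : ι → (ι → ℝ) → ℝ} (hφ : ∀ i, Continuous (φ i)) :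
    Continuous fun p : (ι → ℝ) × (ι → ℝ) => ∫ s in (0 : ℝ)..1,
      ∑ i, (p.1 i - p.2 i) * φ i (p.2 + s • (p.1 - p.2)) := by
  refine intervalIntegral.continuous_parametric_intervalIntegral_of_continuous' ?_ _ _
  unfold Function.uncurry
  fun_prop

lemma continuous_cubeAverage {φ : ι → (ι → ℝ) → ℝ} (hφ : ∀ i, Continuous (φ i)) :
    Continuous (cubeAverage φ) :=
  continuous_parametric_integral_of_continuous
    (f := fun b t => ∫ s in (0 : ℝ)..1, ∑ i, (b i - t i) * φ i (t + s • (b - t)))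
    (continuous_cubeAverage_inner hφ) isCompact_Icc

lemma integrableOn_cubeAverage_inner {φ : ι → (ι → ℝ) → ℝ} (hφ : ∀ i, Continuous (φ i))
    (b : ι → ℝ) :
    IntegrableOn (fun t => ∫ s in (0 : ℝ)..1, ∑ i, (b i - t i) * φ i (t + s • (b - t)))
      (Set.Icc (0 : ι → ℝ) 1) :=
  ((continuous_cubeAverage_inner hφ).comp
    (Continuous.prodMk_right b)).integrableOn_Icc

lemma cubeAverage_sub {φ ψ : ι → (ι → ℝ) → ℝ} (hφ : ∀ i, Continuous (φ i))
    (hψ : ∀ i, Continuous (ψ i)) (b : ι → ℝ) :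
    cubeAverage (fun i x => φ i x - ψ i x) b = cubeAverage φ b - cubeAverage ψ b := by
  unfold cubeAverage
  rw [← integral_sub (integrableOn_cubeAverage_inner hφ b) (integrableOn_cubeAverage_inner hψ b)]
  congr 1
  funext t
  rw [← intervalIntegral.integral_sub]
  · simp only [mul_sub, Finset.sum_sub_distrib]
  all_goals exact Continuous.intervalIntegrable (by fun_prop) _ _

lemma cubeAverage_sum {κ : Type*} (s : Finset κ) {φ : κ → ι → (ι → ℝ) → ℝ}
    (hφ : ∀ k i, Continuous (φ k i)) (r : κ → ℝ) (b : ι → ℝ) :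
    cubeAverage (fun i x => ∑ k ∈ s, φ k i x * r k) b = ∑ k ∈ s, cubeAverage (φ k) b * r k := by
  unfold cubeAverage
  simp_rw [← integral_mul_const]
  rw [← integral_finsetSum _ fun k _ => (integrableOn_cubeAverage_inner (hφ k) b).mul_const _]
  congr 1
  funext t
  simp_rw [← intervalIntegral.integral_mul_const]
  rw [← intervalIntegral.integral_finsetSum]
  · congr 1
    funext u
    simp_rw [Finset.mul_sum, Finset.sum_mul]
    rw [Finset.sum_comm]
    simp_rw [mul_assoc]
  · intro k _
    exact Continuous.intervalIntegrable (by fun_prop) _ _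

lemma abs_cubeAverage_le {φ : ι → (ι → ℝ) → ℝ}
    {M : ι → ℝ} (hM : ∀ i, ∀ x ∈ Set.Icc (0 : ι → ℝ) 1, |φ i x| ≤ M i)
    {b : ι → ℝ} (hb : b ∈ Set.Icc (0 : ι → ℝ) 1) : |cubeAverage φ b| ≤ ∑ i, M i := by
  have hvol : volume.real (Set.Icc (0 : ι → ℝ) 1) = 1 := by
    simp [Measure.real, Real.volume_Icc_pi]
  have hinner : ∀ t ∈ Set.Icc (0 : ι → ℝ) 1,
      ‖∫ s in (0 : ℝ)..1, ∑ i, (b i - t i) * φ i (t + s • (b - t))‖ ≤ ∑ i, M i := by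
    intro t ht
    refine (intervalIntegral.norm_integral_le_of_norm_le_const (C := ∑ i, M i) ?_).trans (by simp)
    intro s hs
    rw [Set.uIoc_of_le zero_le_one] at hs
    refine (norm_sum_le _ _).trans (Finset.sum_le_sum fun i _ => ?_)
    rw [norm_mul, Real.norm_eq_abs, Real.norm_eq_abs]
    have h1 : |b i - t i| ≤ 1 := by
      rw [abs_le]
      have := hb.1 i; have := hb.2 i; have := ht.1 i; have := ht.2 i
      simp only [Pi.zero_apply, Pi.one_apply] at *
      constructor <;> linarith
    have h2 : t + s • (b - t) ∈ Set.Icc (0 : ι → ℝ) 1 :=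
      (convex_Icc _ _).add_smul_sub_mem ht hb ⟨hs.1.le, hs.2⟩
    have h3 := hM i _ h2
    calc _ ≤ 1 * |φ i (t + s • (b - t))| := by gcongr
      _ ≤ M i := by rwa [one_mul]
  have := norm_setIntegral_le_of_norm_le_const (s := Set.Icc (0 : ι → ℝ) 1) (μ := volume)
    (isCompact_Icc.measure_lt_top) hinner
  rwa [hvol, mul_one] at this

lemma cubeAverage_one_sub {φ : ι → (ι → ℝ) → ℝ} {r : ℝ}
    (hφ : ∀ i x, φ i (1 - x) = r * φ i x) (b : ι → ℝ) :
    cubeAverage φ (1 - b) = -r * cubeAverage φ b := by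
  have hmp : MeasurePreserving (fun t : ι → ℝ => 1 - t) volume volume :=
    Measure.measurePreserving_sub_left volume 1
  have hemb : MeasurableEmbedding (fun t : ι → ℝ => 1 - t) :=
    (MeasurableEquiv.subLeft (1 : ι → ℝ)).measurableEmbedding
  have hpre : (fun t : ι → ℝ => 1 - t) ⁻¹' Set.Icc (0 : ι → ℝ) 1 = Set.Icc 0 1 := by
    simp
  unfold cubeAverage
  rw [← hmp.setIntegral_preimage_emb hemb, hpre, ← integral_const_mul]
  congr 1
  funext t
  rw [← intervalIntegral.integral_const_mul]
  congr 1
  funext s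
  rw [Finset.mul_sum]
  refine Finset.sum_congr rfl fun i _ => ?_
  have : (1 - t + s • (1 - b - (1 - t)) : ι → ℝ) = 1 - (t + s • (b - t)) := by
    ext j
    simp only [Pi.add_apply, Pi.sub_apply, Pi.one_apply, Pi.smul_apply, smul_eq_mul]
    ring
  rw [this, hφ]
  simp only [Pi.sub_apply, Pi.one_apply]
  ring

lemma shiftedSum_eq_add_cubeAverage [DecidableEq ι] (R : ℕ) {N : ℕ} (hN : 0 < N)
    {g : (ι → ℝ) → ℝ} (hg : ContDiff ℝ 1 g) (hR : ∀ x, (R : ℝ) < ‖x‖ → g x = 0) (b : ι → ℝ) :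
    shiftedSum R N g b = (∫ x in Set.Ici (0 : ι → ℝ), g x) + (N : ℝ)⁻¹ *
      cubeAverage (fun i => shiftedSum R N (fun x => fderiv ℝ g x (Pi.single i 1))) b := by
  have hvol : volume.real (Set.Icc (0 : ι → ℝ) 1) = 1 := by
    simp [Measure.real, Real.volume_Icc_pi]
  unfold cubeAverage
  rw [← integral_const_mul, ← setIntegral_Icc_shiftedSum R hN hg.continuous hR]
  simp_rw [← shiftedSum_sub_shiftedSum R N hg]
  rw [integral_sub]
  · simp [hvol]
  · exact continuous_const.integrableOn_Icc
  · exact (continuous_shiftedSum R N hg.continuous).integrableOn_Icc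

/-- Asymptotic expansion of shifted lattice sums over the orthant; reflecting the shift `b` at the
centre of the unit cube changes the sign of the coefficients of odd order. -/
theorem exists_expansion_shiftedSum (R W : ℕ) {g : (ι → ℝ) → ℝ} (hg : ContDiff ℝ W g)
    (hR : ∀ x, (R : ℝ) < ‖x‖ → g x = 0) :
    ∃ a : ℕ → (ι → ℝ) → ℝ, (∀ k, Continuous (a k)) ∧
      (∀ k b, a k (1 - b) = (-1) ^ k * a k b) ∧
      ∃ C : ℝ, ∀ N : ℕ, 0 < N → ∀ b ∈ Set.Icc (0 : ι → ℝ) 1,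
        |shiftedSum R N g b - ∑ k ∈ Finset.range W, a k b * (N : ℝ)⁻¹ ^ k| ≤ C * (N : ℝ)⁻¹ ^ W := by
  classical
  induction W generalizing g with
  | zero =>
    have hsupp : HasCompactSupport g := HasCompactSupport.intro
      (isCompact_closedBall (0 : ι → ℝ) R) fun x hx => hR x (by simpa using hx)
    obtain ⟨M, hM⟩ := hg.continuous.bounded_above_of_compact_support hsupp
    refine ⟨fun _ _ => 0, fun _ => continuous_const, by simp, ((R : ℝ) + 1) ^ Fintype.card ι * M,
      fun N hN b _ => ?_⟩
    simpa using abs_shiftedSum_le R hN hM b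
  | succ W ih =>
    have hg1 : ContDiff ℝ 1 g := hg.of_le (by exact_mod_cast Nat.le_add_left 1 W)
    have hh : ∀ i, ContDiff ℝ W fun x => fderiv ℝ g x (Pi.single i 1) := fun i =>
      (hg.fderiv_right (m := W) (by push_cast; rfl)).clm_apply contDiff_const
    have hhR : ∀ i x, (R : ℝ) < ‖x‖ → fderiv ℝ g x (Pi.single i 1) = 0 := by
      intro i x hx
      have : g =ᶠ[𝓝 x] fun _ => 0 := by
        filter_upwards [(isOpen_lt continuous_const continuous_norm).mem_nhds hx] with y hy
        exact hR y hy
      rw [this.fderiv_eq]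
      simp
    choose a ha hpar C hC using fun i => ih (hh i) (hhR i)
    refine ⟨fun k b => Nat.casesOn k (∫ x in Set.Ici (0 : ι → ℝ), g x)
      fun k => cubeAverage (fun i => a i k) b, ?_, ?_, ∑ i, C i, ?_⟩
    · rintro (_ | k)
      · exact continuous_const
      · exact continuous_cubeAverage fun i => ha i k
    · rintro (_ | k) b
      · simp
      · simp only
        rw [cubeAverage_one_sub (fun i => hpar i k) b]
        ring
    · intro N hN b hb
      have hN' : (0 : ℝ) < N := by exact_mod_cast hN
      have hcont : ∀ i, Continuous
          (shiftedSum R N (fun x => fderiv ℝ g x (Pi.single i 1))) := fun i =>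
        continuous_shiftedSum R N (hh i).continuous
      have key : shiftedSum R N g b - ∑ k ∈ Finset.range (W + 1),
          (Nat.casesOn k (∫ x in Set.Ici (0 : ι → ℝ), g x)
            fun k => cubeAverage (fun i => a i k) b : ℝ) * (N : ℝ)⁻¹ ^ k =
          (N : ℝ)⁻¹ * cubeAverage (fun i x =>
            shiftedSum R N (fun x => fderiv ℝ g x (Pi.single i 1)) x -
              ∑ k ∈ Finset.range W, a i k x * (N : ℝ)⁻¹ ^ k) b := by
        rw [cubeAverage_sub hcont (fun i => by have := ha i; fun_prop),
          cubeAverage_sum (φ := fun k i => a i k) _ (fun k i => ha i k),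
          shiftedSum_eq_add_cubeAverage R hN hg1 hR b, Finset.sum_range_succ', mul_sub,
          Finset.mul_sum]
        simp only [pow_zero, mul_one, pow_succ]
        have : ∀ k, cubeAverage (fun i => a i k) b * ((N : ℝ)⁻¹ ^ k * (N : ℝ)⁻¹) =
          (N : ℝ)⁻¹ * (cubeAverage (fun i => a i k) b * (N : ℝ)⁻¹ ^ k) := fun k => by ring
        simp_rw [this]
        simp only [Nat.rec_zero]
        ring
      rw [key, abs_mul, abs_of_pos (inv_pos.2 hN'), pow_succ']
      have := abs_cubeAverage_le (fun i x hx => hC i N hN x hx) hb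
      rw [← Finset.sum_mul] at this
      calc _ ≤ (N : ℝ)⁻¹ * ((∑ i, C i) * (N : ℝ)⁻¹ ^ W) := by gcongr
        _ = _ := by ring

end ShiftedSum

section EvenExpansion

/-- `S N` has an asymptotic expansion in even powers of `1 / N` with error `O(N^{-w-1})`. -/
def HasEvenExpansion (w : ℕ) (S : ℕ → ℝ) : Prop :=
  ∃ a : ℕ → ℝ, ∃ C : ℝ, ∀ N : ℕ, 0 < N →
    |S N - ∑ k ∈ Finset.range (w / 2 + 1), a k * (N : ℝ)⁻¹ ^ (2 * k)| ≤ C * (N : ℝ)⁻¹ ^ (w + 1)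

lemma HasEvenExpansion.congr {w : ℕ} {S T : ℕ → ℝ} (hS : HasEvenExpansion w S)
    (h : ∀ N, 0 < N → T N = S N) : HasEvenExpansion w T := by
  obtain ⟨a, C, hC⟩ := hS
  exact ⟨a, C, fun N hN => by rw [h N hN]; exact hC N hN⟩

lemma HasEvenExpansion.const_mul {w : ℕ} {S : ℕ → ℝ} (hS : HasEvenExpansion w S) (r : ℝ) :
    HasEvenExpansion w fun N => r * S N := by
  obtain ⟨a, C, hC⟩ := hS
  refine ⟨fun k => r * a k, |r| * C, fun N hN => ?_⟩
  simp_rw [mul_assoc]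
  rw [← Finset.mul_sum, ← mul_sub, abs_mul]
  gcongr
  exact hC N hN

lemma HasEvenExpansion.sum {w : ℕ} {κ : Type*} (s : Finset κ) {S : κ → ℕ → ℝ}
    (hS : ∀ i ∈ s, HasEvenExpansion w (S i)) : HasEvenExpansion w fun N => ∑ i ∈ s, S i N := by
  have h : ∀ i, ∃ a : ℕ → ℝ, ∃ C : ℝ, i ∈ s → ∀ N : ℕ, 0 < N →
      |S i N - ∑ k ∈ Finset.range (w / 2 + 1), a k * (N : ℝ)⁻¹ ^ (2 * k)|
        ≤ C * (N : ℝ)⁻¹ ^ (w + 1) := by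
    intro i
    by_cases hi : i ∈ s
    · obtain ⟨a, C, hC⟩ := hS i hi
      exact ⟨a, C, fun _ => hC⟩
    · exact ⟨0, 0, fun h => absurd h hi⟩
  choose a C hC using h
  refine ⟨fun k => ∑ i ∈ s, a i k, ∑ i ∈ s, C i, fun N hN => ?_⟩
  simp_rw [Finset.sum_mul]
  rw [Finset.sum_comm, ← Finset.sum_sub_distrib]
  exact (Finset.abs_sum_le_sum_abs _ _).trans (Finset.sum_le_sum fun i hi => hC i hi N hN)

lemma sum_range_one_add_neg_one_pow_mul (F : ℕ → ℝ) (w : ℕ) :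
    ∑ k ∈ Finset.range (w + 1), (1 + (-1) ^ k) * F k =
      ∑ k ∈ Finset.range (w / 2 + 1), 2 * F (2 * k) := by
  induction w with
  | zero => norm_num
  | succ w ih =>
    rw [Finset.sum_range_succ, ih]
    rcases Nat.even_or_odd' w with ⟨m, rfl | rfl⟩
    · have h1 : (2 * m + 1) / 2 = 2 * m / 2 := by lia
      rw [h1, pow_succ, pow_mul]
      norm_num
    · have h1 : (2 * m + 1 + 1) / 2 = (2 * m + 1) / 2 + 1 := by lia
      have h2 : (2 * m + 1) / 2 + 1 = m + 1 := by lia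
      rw [h1, Finset.sum_range_succ _ ((2 * m + 1) / 2 + 1), h2,
        show 2 * m + 1 + 1 = 2 * (m + 1) by ring, pow_mul]
      norm_num

lemma hasEvenExpansion_shiftedSum_add {ι : Type*} [Fintype ι] (R w : ℕ) {g : (ι → ℝ) → ℝ}
    (hg : ContDiff ℝ (w + 1 : ℕ) g) (hR : ∀ x, (R : ℝ) < ‖x‖ → g x = 0)
    {b : ι → ℝ} (hb : b ∈ Set.Icc (0 : ι → ℝ) 1) :
    HasEvenExpansion w fun N => shiftedSum R N g b + shiftedSum R N g (1 - b) := by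
  obtain ⟨a, -, hpar, C, hC⟩ := exists_expansion_shiftedSum R (w + 1) hg hR
  have hb' : 1 - b ∈ Set.Icc (0 : ι → ℝ) 1 := by
    constructor
    · exact sub_nonneg.2 hb.2
    · exact sub_le_self _ hb.1
  refine ⟨fun k => 2 * a (2 * k) b, C + C, fun N hN => ?_⟩
  have h1 := hC N hN b hb
  have h2 := hC N hN _ hb'
  simp_rw [hpar] at h2
  have h3 : ∑ k ∈ Finset.range (w / 2 + 1), 2 * a (2 * k) b * (N : ℝ)⁻¹ ^ (2 * k) =
      ∑ k ∈ Finset.range (w + 1), a k b * (N : ℝ)⁻¹ ^ k +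
      ∑ k ∈ Finset.range (w + 1), (-1) ^ k * a k b * (N : ℝ)⁻¹ ^ k := by
    have := sum_range_one_add_neg_one_pow_mul (fun k => a k b * (N : ℝ)⁻¹ ^ k) w
    simp_rw [mul_assoc]
    rw [← this, ← Finset.sum_add_distrib]
    exact Finset.sum_congr rfl fun k _ => by ring
  rw [h3, add_mul, add_sub_add_comm]
  exact (abs_add_le _ _).trans (add_le_add h1 h2)

end EvenExpansion

section Cone

/-- The half line `[0, ∞)` or `(0, ∞)`. -/
def halfLine (closed : Bool) : Set ℝ := if closed then Set.Ici 0 else Set.Ioi 0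

/-- The half-open unit interval `[0, 1)` or `(0, 1]`. -/
def unitPart (closed : Bool) : Set ℝ := if closed then Set.Ico 0 1 else Set.Ioc 0 1

lemma unitPart_subset_Icc (c : Bool) : unitPart c ⊆ Set.Icc 0 1 := by
  cases c
  · exact Set.Ioc_subset_Icc_self
  · exact Set.Ico_subset_Icc_self

lemma one_sub_mem_unitPart {c : Bool} {x : ℝ} : 1 - x ∈ unitPart (!c) ↔ x ∈ unitPart c := by
  cases c <;> simp [unitPart] <;> constructor <;> rintro ⟨h1, h2⟩ <;> constructor <;> linarith

lemma natCast_add_mem_halfLine {c : Bool} {x : ℝ} (hx : x ∈ unitPart c) (m : ℕ) :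
    (m : ℝ) + x ∈ halfLine c := by
  have hm : (0 : ℝ) ≤ m := m.cast_nonneg
  cases c
  · exact add_pos_of_nonneg_of_pos hm (show x ∈ Set.Ioc 0 1 from hx).1
  · exact add_nonneg hm (show x ∈ Set.Ico 0 1 from hx).1

lemma exists_sub_natCast_mem_unitPart {c : Bool} {x : ℝ} (hx : x ∈ halfLine c) :
    ∃ m : ℕ, x - m ∈ unitPart c := by
  cases c
  · have hx : 0 < x := hx
    refine ⟨⌈x⌉₊ - 1, ?_⟩
    have h1 := Nat.one_le_ceil_iff.2 hx
    have h2 := Nat.ceil_lt_add_one hx.le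
    have h3 := Nat.le_ceil x
    simp only [unitPart, Bool.false_eq_true, if_false, Set.mem_Ioc]
    push_cast [h1]
    constructor <;> linarith
  · have hx : 0 ≤ x := hx
    refine ⟨⌊x⌋₊, ?_⟩
    have h2 := Nat.lt_floor_add_one x
    have h3 := Nat.floor_le hx
    simp only [unitPart, if_true, Set.mem_Ico]
    constructor <;> linarith

lemma eq_of_natCast_add_eq {c : Bool} {x y : ℝ} (hx : x ∈ unitPart c) (hy : y ∈ unitPart c)
    {m n : ℕ} (h : (m : ℝ) + x = n + y) : m = n := by
  have h1 : (m : ℝ) < n + 1 ∧ (n : ℝ) < m + 1 := by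
    cases c
    · have hx : x ∈ Set.Ioc (0 : ℝ) 1 := hx
      have hy : y ∈ Set.Ioc (0 : ℝ) 1 := hy
      exact ⟨by linarith [hx.1, hy.2], by linarith [hx.2, hy.1]⟩
    · have hx : x ∈ Set.Ico (0 : ℝ) 1 := hx
      have hy : y ∈ Set.Ico (0 : ℝ) 1 := hy
      exact ⟨by linarith [hx.1, hy.2], by linarith [hx.2, hy.1]⟩
  have h2 : m < n + 1 := by exact_mod_cast h1.1
  have h3 : n < m + 1 := by exact_mod_cast h1.2
  lia

lemma mul_mem_halfLine {c : Bool} {r x : ℝ} (hr : 0 < r) : r * x ∈ halfLine c ↔ x ∈ halfLine c := by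
  cases c
  · exact mul_pos_iff_of_pos_left hr
  · exact mul_nonneg_iff_of_pos_left hr

/-- The real vector with the given integer coordinates. -/
def intVec {d : ℕ} (n : Fin d → ℤ) : Fin d → ℝ := fun i => (n i : ℝ)

/-- The normalized sum of `F` over the points of `N⁻¹ ℤ^d`. -/
noncomputable def latticeSum {d : ℕ} (F : (Fin d → ℝ) → ℝ) (N : ℕ) : ℝ :=
  ((N : ℝ) ^ d)⁻¹ * ∑' n : Fin d → ℤ, F ((N : ℝ)⁻¹ • intVec n)

variable {d : ℕ} {ι : Type*} [Fintype ι]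

/-- The half-open simplicial cone with apex `v`, generators `u i`, and closed facets prescribed
by `τ`. -/
def simplicialCone (v : Fin d → ℝ) (u : Module.Basis ι ℝ (Fin d → ℝ)) (τ : ι → Bool) :
    Set (Fin d → ℝ) :=
  {x | ∀ i, u.equivFun (x - v) i ∈ halfLine (τ i)}

/-- The lattice points in the half-open parallelepiped spanned by `u`. -/
def boxPoints (u : Module.Basis ι ℝ (Fin d → ℝ)) (τ : ι → Bool) : Set (Fin d → ℤ) :=
  {z | ∀ i, u.equivFun (intVec z) i ∈ unitPart (τ i)}

lemma finite_intVec_mem_of_isBounded {s : Set (Fin d → ℝ)} (hs : Bornology.IsBounded s) :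
    {z : Fin d → ℤ | intVec z ∈ s}.Finite := by
  obtain ⟨r, hr⟩ := hs.exists_norm_le
  refine (Set.finite_Icc (fun _ : Fin d => -⌈r⌉) (fun _ => ⌈r⌉)).subset fun z hz => ?_
  have h : ∀ i, |(z i : ℝ)| ≤ ⌈r⌉ := fun i =>
    ((norm_le_pi_norm (intVec z) i).trans (hr _ hz)).trans (Int.le_ceil r)
  constructor <;> intro i <;> have := abs_le.1 (h i)
  · exact_mod_cast this.1
  · exact_mod_cast this.2

lemma finite_boxPoints (u : Module.Basis ι ℝ (Fin d → ℝ)) (τ : ι → Bool) :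
    (boxPoints u τ).Finite := by
  have hcomp : IsCompact (u.equivFun.symm '' Set.Icc (0 : ι → ℝ) 1) :=
    isCompact_Icc.image u.equivFun.symm.toLinearMap.continuous_of_finiteDimensional
  refine (finite_intVec_mem_of_isBounded hcomp.isBounded).subset fun z hz => ?_
  refine ⟨u.equivFun (intVec z), ⟨fun i => ?_, fun i => ?_⟩, by simp⟩
  · exact (unitPart_subset_Icc _ (hz i)).1
  · exact (unitPart_subset_Icc _ (hz i)).2

lemma equivFun_sum_intVec (u : Module.Basis ι ℝ (Fin d → ℝ)) {z : ι → Fin d → ℤ}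
    (hz : ∀ i, u i = intVec (z i)) (m : ι → ℤ) :
    u.equivFun (intVec (∑ i, m i • z i)) = fun i => (m i : ℝ) := by
  have : intVec (∑ i, m i • z i) = u.equivFun.symm fun i => (m i : ℝ) := by
    rw [Module.Basis.equivFun_symm_apply]
    ext j
    simp [hz, intVec, Finset.sum_apply]
  rw [this, LinearEquiv.apply_symm_apply]

lemma intVec_add (m n : Fin d → ℤ) : intVec (m + n) = intVec m + intVec n := by
  ext; simp [intVec]

lemma intVec_sub (m n : Fin d → ℤ) : intVec (m - n) = intVec m - intVec n := by
  ext; simp [intVec]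

lemma intVec_natCast_smul (N : ℕ) (n : Fin d → ℤ) : intVec ((N : ℤ) • n) = (N : ℝ) • intVec n := by
  ext; simp [intVec]

lemma latticeSum_simplicialCone (hcard : Fintype.card ι = d) (v : Fin d → ℤ)
    (u : Module.Basis ι ℝ (Fin d → ℝ)) {z : ι → Fin d → ℤ} (hz : ∀ i, u i = intVec (z i))
    (τ : ι → Bool) {f : (Fin d → ℝ) → ℝ} {R : ℕ}
    (hR : ∀ μ : ι → ℝ, (R : ℝ) < ‖μ‖ → f (intVec v + u.equivFun.symm μ) = 0)
    {N : ℕ} (hN : 0 < N) :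
    latticeSum ((simplicialCone (intVec v) u τ).indicator f) N =
      ∑ b ∈ (finite_boxPoints u τ).toFinset,
        shiftedSum R N (fun μ => f (intVec v + u.equivFun.symm μ)) (u.equivFun (intVec b)) := by
  classical
  have hN' : (0 : ℝ) < N := by exact_mod_cast hN
  let φ : (finite_boxPoints u τ).toFinset × (ι → ℕ) → (Fin d → ℤ) := fun p =>
    (N : ℤ) • v + (p.1 + ∑ i, (p.2 i : ℤ) • z i)
  have hφ : ∀ p, u.equivFun (intVec (φ p) - (N : ℝ) • intVec v) =
      (fun i => (p.2 i : ℝ)) + u.equivFun (intVec p.1) := by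
    intro p
    have := equivFun_sum_intVec u hz fun i => (p.2 i : ℤ)
    simp only [φ, intVec_add, intVec_natCast_smul, add_sub_cancel_left, map_add]
    rw [this, add_comm]
    simp
  have hbox : ∀ b : (finite_boxPoints u τ).toFinset, ∀ i,
      u.equivFun (intVec b) i ∈ unitPart (τ i) := fun b =>
    (finite_boxPoints u τ).mem_toFinset.1 b.2
  have hinj : Function.Injective φ := by
    intro p q hpq
    have h := hφ p
    rw [hpq, hφ q] at h
    have h2 : p.2 = q.2 := funext fun i =>
      (eq_of_natCast_add_eq (hbox q.1 i) (hbox p.1 i) (congrFun h i)).symm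
    refine Prod.ext (Subtype.ext ?_) h2
    have h3 := hpq
    simp only [φ, h2, add_right_inj, add_left_inj] at h3
    exact h3
  have hscale : ∀ n : Fin d → ℤ, u.equivFun ((N : ℝ)⁻¹ • intVec n - intVec v) =
      (N : ℝ)⁻¹ • u.equivFun (intVec n - (N : ℝ) • intVec v) := by
    intro n
    rw [← map_smul, smul_sub, inv_smul_smul₀ hN'.ne']
  have hsupp : Function.support (fun n : Fin d → ℤ =>
      (simplicialCone (intVec v) u τ).indicator f ((N : ℝ)⁻¹ • intVec n)) ⊆ Set.range φ := by
    intro n hn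
    have hmem : (N : ℝ)⁻¹ • intVec n ∈ simplicialCone (intVec v) u τ :=
      Set.mem_of_indicator_ne_zero hn
    have h1 : ∀ i, u.equivFun (intVec n - (N : ℝ) • intVec v) i ∈ halfLine (τ i) := by
      intro i
      have := hmem i
      rwa [hscale, Pi.smul_apply, smul_eq_mul, mul_mem_halfLine (inv_pos.2 hN')] at this
    choose m hm using fun i => exists_sub_natCast_mem_unitPart (h1 i)
    refine ⟨(⟨n - (N : ℤ) • v - ∑ i, (m i : ℤ) • z i,
      (finite_boxPoints u τ).mem_toFinset.2 fun i => ?_⟩, m), ?_⟩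
    · have := equivFun_sum_intVec u hz fun i => (m i : ℤ)
      rw [intVec_sub, map_sub, intVec_sub, intVec_natCast_smul, this]
      simpa using hm i
    · simp only [φ]
      abel
  have hval : ∀ p, (simplicialCone (intVec v) u τ).indicator f ((N : ℝ)⁻¹ • intVec (φ p)) =
      f (intVec v + u.equivFun.symm ((N : ℝ)⁻¹ •
        ((fun i => (p.2 i : ℝ)) + u.equivFun (intVec p.1)))) := by
    intro p
    have h1 : (N : ℝ)⁻¹ • intVec (φ p) ∈ simplicialCone (intVec v) u τ := by
      intro i
      rw [hscale, hφ, Pi.smul_apply, smul_eq_mul, mul_mem_halfLine (inv_pos.2 hN')]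
      exact natCast_add_mem_halfLine (hbox p.1 i) _
    rw [Set.indicator_of_mem h1, ← hφ p, ← hscale, LinearEquiv.symm_apply_apply, add_sub_cancel]
  unfold latticeSum
  rw [← hinj.tsum_eq hsupp]
  simp_rw [hval]
  rw [tsum_eq_sum (s := Finset.univ ×ˢ Fintype.piFinset (fun _ : ι => Finset.range (R * N + 1))),
    Finset.sum_product, Finset.sum_coe_sort (finite_boxPoints u τ).toFinset (fun b =>
      ∑ m ∈ Fintype.piFinset (fun _ : ι => Finset.range (R * N + 1)),
        f (intVec v + u.equivFun.symm ((N : ℝ)⁻¹ •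
          ((fun i => (m i : ℝ)) + u.equivFun (intVec b))))), Finset.mul_sum]
  · unfold shiftedSum
    rw [hcard]
  · intro p hp
    apply hR
    simp only [Finset.mem_product, Finset.mem_univ, true_and, Fintype.mem_piFinset,
      Finset.mem_range, not_forall, not_lt] at hp
    obtain ⟨i, hi⟩ := hp
    have hi' : (R : ℝ) * N + 1 ≤ p.2 i := by exact_mod_cast hi
    have hb := (unitPart_subset_Icc _ (hbox p.1 i)).1
    refine lt_of_lt_of_le ?_ ((le_abs_self _).trans (norm_le_pi_norm
      ((N : ℝ)⁻¹ • ((fun i => (p.2 i : ℝ)) + u.equivFun (intVec p.1))) i))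
    rw [Pi.smul_apply, smul_eq_mul, inv_mul_eq_div, lt_div_iff₀ hN', Pi.add_apply]
    linarith

theorem hasEvenExpansion_simplicialCone (hcard : Fintype.card ι = d) (v : Fin d → ℤ)
    (u : Module.Basis ι ℝ (Fin d → ℝ)) (hu : ∀ i, ∃ z : Fin d → ℤ, u i = intVec z)
    (τ : ι → Bool) {f : (Fin d → ℝ) → ℝ} (w : ℕ) (hf : ContDiff ℝ (w + 1 : ℕ) f)
    (hsupp : HasCompactSupport f) :
    HasEvenExpansion w fun N =>
      latticeSum ((simplicialCone (intVec v) u τ).indicator f) N +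
      latticeSum ((simplicialCone (intVec v) u fun i => !τ i).indicator f) N := by
  classical
  choose z hz using hu
  obtain ⟨r, hr⟩ := (hsupp.isCompact.image (f := fun x => u.equivFun (x - intVec v))
    (u.equivFun.toLinearMap.continuous_of_finiteDimensional.comp
      (continuous_id.sub continuous_const))).isBounded.exists_norm_le
  have hR : ∀ μ : ι → ℝ, ((⌈r⌉₊ : ℕ) : ℝ) < ‖μ‖ → f (intVec v + u.equivFun.symm μ) = 0 := by
    intro μ hμ
    by_contra hne
    have := hr μ ⟨intVec v + u.equivFun.symm μ, subset_tsupport _ hne,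
      by simp only [add_sub_cancel_left, LinearEquiv.apply_symm_apply]⟩
    exact absurd ((Nat.le_ceil r).trans_lt hμ) (not_lt.2 this)
  have hg : ContDiff ℝ (w + 1 : ℕ) fun μ : ι → ℝ => f (intVec v + u.equivFun.symm μ) :=
    hf.comp (contDiff_const.add
      (LinearMap.toContinuousLinearMap u.equivFun.symm.toLinearMap).contDiff)
  refine (HasEvenExpansion.sum (finite_boxPoints u τ).toFinset fun b hb =>
    hasEvenExpansion_shiftedSum_add ⌈r⌉₊ w hg hR (b := u.equivFun (intVec b)) ?_).congr ?_
  · have hb := (finite_boxPoints u τ).mem_toFinset.1 hb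
    exact ⟨fun i => (unitPart_subset_Icc _ (hb i)).1, fun i => (unitPart_subset_Icc _ (hb i)).2⟩
  · intro N hN
    rw [latticeSum_simplicialCone hcard v u hz τ hR hN,
      latticeSum_simplicialCone hcard v u hz _ hR hN, Finset.sum_add_distrib]
    congr 1
    have hone : ∀ b : Fin d → ℤ, u.equivFun (intVec (∑ i, z i - b)) =
        1 - u.equivFun (intVec b) := by
      intro b
      have := equivFun_sum_intVec u hz fun _ => 1
      simp only [one_smul] at this
      rw [intVec_sub, map_sub, this]
      ext
      simp
    have hmem : ∀ (τ : ι → Bool) (b : Fin d → ℤ), b ∈ boxPoints u τ →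
        ∑ i, z i - b ∈ boxPoints u fun i => !τ i := by
      intro τ b hb i
      rw [hone]
      exact one_sub_mem_unitPart.2 (hb i)
    refine Finset.sum_nbij' (fun b => ∑ i, z i - b) (fun b => ∑ i, z i - b) ?_ ?_ ?_ ?_ ?_
    · intro b hb
      have := hmem _ b ((Set.Finite.mem_toFinset _).1 hb)
      simpa using this
    · intro b hb
      have := hmem _ b ((Set.Finite.mem_toFinset _).1 hb)
      simpa using this
    · simp
    · simp
    · intro b _
      rw [hone]
      simp

end Cone

section Simplex

open scoped Pointwise

variable {d : ℕ}

lemma summable_latticeSum {F : (Fin d → ℝ) → ℝ} {s : Set (Fin d → ℝ)}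
    (hs : Bornology.IsBounded s) (hF : ∀ x ∉ s, F x = 0) {N : ℕ} (hN : 0 < N) :
    Summable fun n : Fin d → ℤ => F ((N : ℝ)⁻¹ • intVec n) := by
  have hN' : (N : ℝ) ≠ 0 := by exact_mod_cast hN.ne'
  refine summable_of_hasFiniteSupport
    ((finite_intVec_mem_of_isBounded (hs.smul₀ (N : ℝ))).subset fun n hn => ?_)
  refine ⟨(N : ℝ)⁻¹ • intVec n, ?_, smul_inv_smul₀ hN' _⟩
  by_contra h
  exact hn (hF _ h)

lemma latticeSum_finsetSum {κ : Type*} (t : Finset κ) {F : κ → (Fin d → ℝ) → ℝ}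
    {s : Set (Fin d → ℝ)} (hs : Bornology.IsBounded s) (hF : ∀ k, ∀ x ∉ s, F k x = 0)
    (r : κ → ℝ) {N : ℕ} (hN : 0 < N) :
    latticeSum (fun x => ∑ k ∈ t, r k * F k x) N = ∑ k ∈ t, r k * latticeSum (F k) N := by
  unfold latticeSum
  rw [Summable.tsum_finsetSum fun k _ => (summable_latticeSum hs (hF k) hN).mul_left (r k),
    Finset.mul_sum]
  refine Finset.sum_congr rfl fun k _ => ?_
  rw [tsum_mul_left]
  ring

lemma tendsto_latticeSum_indicator {f : (Fin d → ℝ) → ℝ} (hf : Continuous f)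
    {s : Set (Fin d → ℝ)} (hb : Bornology.IsBounded s) (hm : MeasurableSet s)
    (hfr : volume (frontier s) = 0) :
    Tendsto (latticeSum (s.indicator f)) atTop (𝓝 (∫ x in s, f x)) := by
  refine (tendsto_tsum_div_pow_atTop_integral s f hf hb hm hfr).congr' ?_
  filter_upwards [eventually_gt_atTop 0] with N hN
  have hN' : (N : ℝ) ≠ 0 := by exact_mod_cast hN.ne'
  let L : Set (Fin d → ℝ) := Submodule.span ℤ (Set.range (Pi.basisFun ℝ (Fin d)))
  have hL : ∀ y, y ∈ L ↔ ∃ n : Fin d → ℤ, intVec n = y := by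
    intro y
    simp only [L, SetLike.mem_coe, Module.Basis.mem_span_iff_repr_mem, Pi.basisFun_repr]
    constructor
    · intro h
      choose n hn using h
      exact ⟨n, funext fun i => by simpa [intVec] using hn i⟩
    · rintro ⟨n, rfl⟩ i
      exact ⟨n i, by simp [intVec]⟩
  have hinj : Function.Injective fun n : Fin d → ℤ => (N : ℝ)⁻¹ • intVec n := by
    intro m n h
    have h' : intVec m = intVec n := smul_right_injective _ (inv_ne_zero hN') h
    exact funext fun i => Int.cast_injective (congrFun h' i)
  have hrange : (N : ℝ)⁻¹ • L = Set.range fun n : Fin d → ℤ => (N : ℝ)⁻¹ • intVec n := by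
    ext x
    simp only [Set.mem_smul_set, hL, Set.mem_range]
    constructor
    · rintro ⟨_, ⟨n, rfl⟩, rfl⟩
      exact ⟨n, rfl⟩
    · rintro ⟨n, rfl⟩
      exact ⟨_, ⟨n, rfl⟩, rfl⟩
  have h1 : (∑' x : ↑(s ∩ (N : ℝ)⁻¹ • L), f x) =
      ∑' n : Fin d → ℤ, s.indicator f ((N : ℝ)⁻¹ • intVec n) := by
    rw [tsum_subtype (s ∩ (N : ℝ)⁻¹ • L) f, Set.inter_comm, ← Set.indicator_indicator,
      ← tsum_subtype ((N : ℝ)⁻¹ • L) (s.indicator f), hrange, tsum_range (s.indicator f) hinj]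
  rw [latticeSum, ← h1, Fintype.card_fin, div_eq_inv_mul]

lemma sum_alternating_prod_ite {R : Type*} [CommRing R] (n : ℕ) (p q : Fin (n + 1) → R)
    (hpq : ∀ i, p i + q i = 1) :
    ∑ k : Fin (n + 1), (-1) ^ (n - (k : ℕ)) *
      ∏ i, (if i = k then 1 else if i < k then p i else q i) =
      ∏ i, p i + (-1) ^ n * ∏ i, q i := by
  induction n with
  | zero => simp [hpq]
  | succ n ih =>
    have h := ih (fun i => p i.castSucc) (fun i => q i.castSucc) fun i => hpq _
    have hstep : ∀ k : Fin (n + 1), (-1 : R) ^ (n + 1 - (k : ℕ)) = -(-1) ^ (n - (k : ℕ)) := by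
      intro k
      rw [Nat.succ_sub (Nat.lt_succ_iff.1 k.2), pow_succ]
      ring
    have hprod : ∀ k : Fin (n + 1),
        ∏ i, (if i = k.castSucc then 1 else if i < k.castSucc then p i else q i) =
          (∏ i : Fin (n + 1), (if i = k then 1 else if i < k then p i.castSucc else q i.castSucc)) *
            q (Fin.last (n + 1)) := by
      intro k
      rw [Fin.prod_univ_castSucc]
      simp [(Fin.castSucc_ne_last k).symm, (Fin.castSucc_lt_last k).not_gt]
    have hlast : ∏ i, (if i = Fin.last (n + 1) then 1 else
        if i < Fin.last (n + 1) then p i else q i) = ∏ i : Fin (n + 1), p i.castSucc := by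
      rw [Fin.prod_univ_castSucc]
      simp [Fin.castSucc_lt_last]
    rw [Fin.sum_univ_castSucc, hlast, Fin.prod_univ_castSucc p, Fin.prod_univ_castSucc q]
    simp only [hprod, Fin.val_castSucc, hstep, Fin.val_last, tsub_self, pow_zero, one_mul,
      neg_mul, Finset.sum_neg_distrib, ← mul_assoc, ← Finset.sum_mul, h]
    linear_combination (-(∏ i : Fin (n + 1), p i.castSucc)) * hpq (Fin.last (n + 1))

/-- The simplex with vertices `B`, where the facet opposite to `B i` is included if and only if
`σ i` is true. -/
def halfOpenSimplex (B : AffineBasis (Fin (d + 1)) ℝ (Fin d → ℝ)) (σ : Fin (d + 1) → Bool) :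
    Set (Fin d → ℝ) :=
  {x | ∀ i, B.coord i x ∈ halfLine (σ i)}

lemma linear_coord_eq_coord_basisOf (B : AffineBasis (Fin (d + 1)) ℝ (Fin d → ℝ))
    (k : Fin (d + 1)) (i : {j // j ≠ k}) : (B.coord i).linear = (B.basisOf k).coord i := by
  refine (B.basisOf k).ext fun j => ?_
  rw [Module.Basis.coord_apply, Module.Basis.repr_self, AffineBasis.basisOf_apply,
    AffineMap.linearMap_vsub, B.coord_apply_ne i.2, B.coord_apply]
  simp [Finsupp.single_apply, Subtype.ext_iff, eq_comm]

lemma coord_eq_repr_basisOf (B : AffineBasis (Fin (d + 1)) ℝ (Fin d → ℝ))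
    (k : Fin (d + 1)) (i : {j // j ≠ k}) (x : Fin d → ℝ) :
    B.coord i x = (B.basisOf k).repr (x - B k) i := by
  have h := (B.coord i).linearMap_vsub x (B k)
  rw [B.coord_apply_ne i.2, linear_coord_eq_coord_basisOf B k i] at h
  simpa using h.symm

/-- The edge directions at the vertex `B k`, oriented away from `B k` for the smaller indices and
towards `B k` for the larger ones. -/
noncomputable def orientedEdges (B : AffineBasis (Fin (d + 1)) ℝ (Fin d → ℝ)) (k : Fin (d + 1)) :
    Module.Basis {j // j ≠ k} ℝ (Fin d → ℝ) :=
  (B.basisOf k).unitsSMul fun i => if i.1 < k then 1 else -1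

/-- The half-open cone at the vertex `B k` spanned by the oriented edges. -/
noncomputable def vertexCone (B : AffineBasis (Fin (d + 1)) ℝ (Fin d → ℝ))
    (σ : Fin (d + 1) → Bool) (k : Fin (d + 1)) : Set (Fin d → ℝ) :=
  simplicialCone (B k) (orientedEdges B k) fun i => if i.1 < k then σ i else !σ i

lemma mem_vertexCone (B : AffineBasis (Fin (d + 1)) ℝ (Fin d → ℝ))
    (σ : Fin (d + 1) → Bool) (k : Fin (d + 1)) (x : Fin d → ℝ) :
    x ∈ vertexCone B σ k ↔ ∀ i, i ≠ k →
      if i < k then B.coord i x ∈ halfLine (σ i) else -B.coord i x ∈ halfLine (!σ i) := by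
  simp only [vertexCone, simplicialCone, Set.mem_ofPred_eq, Subtype.forall,
    Module.Basis.equivFun_apply, orientedEdges, Module.Basis.repr_unitsSMul]
  refine forall_congr' fun i => forall_congr' fun hi => ?_
  rw [← coord_eq_repr_basisOf B k ⟨i, hi⟩ x]
  split_ifs <;> simp [Units.smul_def]

lemma neg_mem_halfLine_not {c : Bool} {x : ℝ} : -x ∈ halfLine (!c) ↔ x ∉ halfLine c := by
  cases c <;> simp [halfLine]

/-- Polar decomposition of a half-open simplex into half-open cones at its vertices. -/
lemma indicator_halfOpenSimplex (B : AffineBasis (Fin (d + 1)) ℝ (Fin d → ℝ))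
    (σ : Fin (d + 1) → Bool) (f : (Fin d → ℝ) → ℝ) (x : Fin d → ℝ) :
    (halfOpenSimplex B σ).indicator f x =
      ∑ k : Fin (d + 1), (-1) ^ (d - (k : ℕ)) * (vertexCone B σ k).indicator f x := by
  classical
  let p : Fin (d + 1) → ℝ := fun i => if B.coord i x ∈ halfLine (σ i) then 1 else 0
  let q : Fin (d + 1) → ℝ := fun i => if B.coord i x ∈ halfLine (σ i) then 0 else 1
  have h := sum_alternating_prod_ite d p q fun i => by simp only [p, q]; split_ifs <;> norm_num
  have hq : ∏ i, q i = 0 := by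
    have : ∃ i, 0 < B.coord i x := by
      by_contra! hneg
      have := Finset.sum_nonpos fun i (_ : i ∈ Finset.univ) => hneg i
      rw [B.sum_coord_apply_eq_one] at this
      linarith
    obtain ⟨i, hi⟩ := this
    refine Finset.prod_eq_zero (Finset.mem_univ i) (if_pos ?_)
    cases σ i
    · exact hi
    · exact hi.le
  have hp : (halfOpenSimplex B σ).indicator f x = (∏ i, p i) * f x := by
    simp only [p, Finset.prod_ite_zero, Finset.mem_univ, true_imp_iff, Finset.prod_const_one]
    by_cases hx : ∀ i, B.coord i x ∈ halfLine (σ i)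
    · rw [if_pos hx, Set.indicator_of_mem (by exact hx), one_mul]
    · rw [if_neg hx, Set.indicator_of_notMem (by exact hx), zero_mul]
  have hcone : ∀ k, (vertexCone B σ k).indicator f x =
      (∏ i, (if i = k then 1 else if i < k then p i else q i)) * f x := by
    intro k
    have : ∀ i, (if i = k then 1 else if i < k then p i else q i) =
        if (i ≠ k → if i < k then B.coord i x ∈ halfLine (σ i)
          else -B.coord i x ∈ halfLine (!σ i)) then (1 : ℝ) else 0 := by
      intro i
      simp only [p, q, neg_mem_halfLine_not]
      split_ifs <;> simp_all
    simp only [this, Finset.prod_ite_zero, Finset.mem_univ, true_imp_iff, Finset.prod_const_one,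
      ← mem_vertexCone]
    by_cases hx : x ∈ vertexCone B σ k
    · rw [if_pos hx, Set.indicator_of_mem (by exact hx), one_mul]
    · rw [if_neg hx, Set.indicator_of_notMem (by exact hx), zero_mul]
  rw [hq, mul_zero, add_zero] at h
  rw [hp, ← h, Finset.sum_mul]
  refine Finset.sum_congr rfl fun k _ => ?_
  rw [hcone]
  ring

theorem hasEvenExpansion_halfOpenSimplex (B : AffineBasis (Fin (d + 1)) ℝ (Fin d → ℝ))
    (hB : ∀ i, ∃ z : Fin d → ℤ, B i = intVec z) (σ : Fin (d + 1) → Bool)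
    {f : (Fin d → ℝ) → ℝ} (w : ℕ) (hf : ContDiff ℝ (w + 1 : ℕ) f) (hsupp : HasCompactSupport f) :
    HasEvenExpansion w fun N =>
      latticeSum ((halfOpenSimplex B σ).indicator f) N +
      latticeSum ((halfOpenSimplex B fun i => !σ i).indicator f) N := by
  have hcone : ∀ k, HasEvenExpansion w fun N =>
      latticeSum ((vertexCone B σ k).indicator f) N +
      latticeSum ((vertexCone B (fun i => !σ i) k).indicator f) N := by
    intro k
    obtain ⟨v, hv⟩ := hB k
    have hu : ∀ i, ∃ z : Fin d → ℤ, orientedEdges B k i = intVec z := by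
      intro i
      obtain ⟨v', hv'⟩ := hB i
      rw [orientedEdges, Module.Basis.unitsSMul_apply, AffineBasis.basisOf_apply, hv, hv']
      split_ifs
      · exact ⟨v' - v, by simp [intVec_sub]⟩
      · exact ⟨v - v', by simp [intVec_sub, Units.smul_def]⟩
    have := hasEvenExpansion_simplicialCone (by simp) v (orientedEdges B k) hu
      (fun i => if i.1 < k then σ i else !σ i) w hf hsupp
    have hflip : (fun i : {j // j ≠ k} => !(if i.1 < k then σ i else !σ i)) =
        fun i : {j // j ≠ k} => if i.1 < k then !σ i else !!σ i := by
      funext i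
      split_ifs <;> rfl
    rw [hflip, ← hv] at this
    exact this
  have hsum : ∀ τ N, 0 < N → latticeSum ((halfOpenSimplex B τ).indicator f) N =
      ∑ k : Fin (d + 1), (-1) ^ (d - (k : ℕ)) * latticeSum ((vertexCone B τ k).indicator f) N := by
    intro τ N hN
    rw [← latticeSum_finsetSum _ hsupp.isCompact.isBounded _ _ hN]
    · congr 1
      funext x
      exact indicator_halfOpenSimplex B τ f x
    · intro k x hx
      simp [Set.indicator, image_eq_zero_of_notMem_tsupport hx]
  refine (HasEvenExpansion.sum Finset.univ fun k _ =>
    (hcone k).const_mul ((-1) ^ (d - (k : ℕ)))).congr fun N hN => ?_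
  rw [hsum _ N hN, hsum _ N hN, ← Finset.sum_add_distrib]
  simp_rw [mul_add]

end Simplex

section SolidAngle

variable {d : ℕ}

lemma measurableSet_euclideanBall : MeasurableSet (eball d) :=
  (isClosed_le (by fun_prop) continuous_const).measurableSet

lemma volume_eball_lt_top : volume (eball d) < ⊤ := by
  refine (measure_mono fun y hy => ?_).trans_lt (measure_closedBall_lt_top (x := 0) (r := 1))
  rw [mem_closedBall_zero_iff, pi_norm_le_iff_of_nonneg zero_le_one]
  intro i
  have h : (y i) ^ 2 ≤ 1 :=
    (Finset.single_le_sum (fun j _ => sq_nonneg (y j)) (Finset.mem_univ i)).trans hy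
  exact (sq_le_one_iff_abs_le_one _).1 h

lemma volume_real_eball_pos : 0 < volume.real (eball d) := by
  refine ENNReal.toReal_pos (ne_of_gt ?_) volume_eball_lt_top.ne
  have hopen : IsOpen {y : Fin d → ℝ | ∑ i, (y i) ^ 2 < 1} :=
    isOpen_lt (by fun_prop) continuous_const
  exact (hopen.measure_pos volume ⟨0, by simp⟩).trans_le
    (measure_mono fun y (hy : ∑ i, (y i) ^ 2 < 1) => hy.le)

lemma coord_linear_ne_zero (hd : 1 ≤ d) (B : AffineBasis (Fin (d + 1)) ℝ (Fin d → ℝ))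
    (i : Fin (d + 1)) : (B.coord i).linear ≠ 0 := by
  intro h
  have : Nontrivial (Fin (d + 1)) := Fin.nontrivial_iff_two_le.2 (by omega)
  obtain ⟨j, hj⟩ := exists_ne i
  have h' := (B.coord i).linearMap_vsub (B i) (B j)
  rw [h, B.coord_apply_eq, B.coord_apply_ne hj.symm] at h'
  simp at h'

lemma ae_linear_coord_ne_zero (hd : 1 ≤ d) (B : AffineBasis (Fin (d + 1)) ℝ (Fin d → ℝ)) :
    ∀ᵐ y : Fin d → ℝ, ∀ i, (B.coord i).linear y ≠ 0 := by
  refine ae_all_iff.2 fun i => ?_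
  have h := Measure.addHaar_submodule volume (B.coord i).linear.ker
    (fun h => coord_linear_ne_zero hd B i (LinearMap.ker_eq_top.1 h))
  rw [ae_iff]
  simp only [ne_eq, not_not]
  exact h

lemma ae_coord_ne_zero (hd : 1 ≤ d) (B : AffineBasis (Fin (d + 1)) ℝ (Fin d → ℝ)) :
    ∀ᵐ x : Fin d → ℝ, ∀ i, B.coord i x ≠ 0 := by
  refine ae_all_iff.2 fun i => ?_
  have : Nontrivial (Fin (d + 1)) := Fin.nontrivial_iff_two_le.2 (by omega)
  obtain ⟨j, hj⟩ := exists_ne i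
  filter_upwards [(measurePreserving_sub_right volume (B j)).quasiMeasurePreserving.ae
    (ae_linear_coord_ne_zero hd B)] with x hx
  have h' := (B.coord i).linearMap_vsub x (B j)
  rw [B.coord_apply_ne hj.symm, vsub_eq_sub, vsub_eq_sub, sub_zero] at h'
  exact h' ▸ hx i

lemma convex_halfLine (c : Bool) : Convex ℝ (halfLine c) := by
  cases c
  · exact convex_Ioi 0
  · exact convex_Ici 0

lemma measurableSet_halfLine (c : Bool) : MeasurableSet (halfLine c) := by
  cases c
  · exact measurableSet_Ioi
  · exact measurableSet_Ici

lemma measurableSet_halfOpenSimplex (B : AffineBasis (Fin (d + 1)) ℝ (Fin d → ℝ))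
    (σ : Fin (d + 1) → Bool) : MeasurableSet (halfOpenSimplex B σ) := by
  simp only [halfOpenSimplex, Set.ofPred_forall]
  exact MeasurableSet.iInter fun i =>
    (B.coord i).continuous_of_finiteDimensional.measurable (measurableSet_halfLine _)

lemma convex_halfOpenSimplex (B : AffineBasis (Fin (d + 1)) ℝ (Fin d → ℝ))
    (σ : Fin (d + 1) → Bool) : Convex ℝ (halfOpenSimplex B σ) := by
  simp only [halfOpenSimplex, Set.ofPred_forall]
  exact convex_iInter fun i => (convex_halfLine _).affine_preimage (B.coord i)

lemma convexHull_eq_halfOpenSimplex (B : AffineBasis (Fin (d + 1)) ℝ (Fin d → ℝ)) :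
    convexHull ℝ (Set.range B) = halfOpenSimplex B fun _ => true := by
  rw [B.convexHull_eq_nonneg_coord]
  rfl

lemma halfOpenSimplex_subset (B : AffineBasis (Fin (d + 1)) ℝ (Fin d → ℝ))
    (σ : Fin (d + 1) → Bool) : halfOpenSimplex B σ ⊆ halfOpenSimplex B fun _ => true := by
  intro x hx i
  have := hx i
  cases h : σ i
  · rw [h] at this
    exact Set.Ioi_subset_Ici_self this
  · rwa [h] at this

lemma isBounded_halfOpenSimplex (B : AffineBasis (Fin (d + 1)) ℝ (Fin d → ℝ))
    (σ : Fin (d + 1) → Bool) : Bornology.IsBounded (halfOpenSimplex B σ) := by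
  refine Bornology.IsBounded.subset ?_ (halfOpenSimplex_subset B σ)
  rw [← convexHull_eq_halfOpenSimplex, isBounded_convexHull]
  exact (Set.finite_range B).isBounded

lemma halfOpenSimplex_ae_eq (hd : 1 ≤ d) (B : AffineBasis (Fin (d + 1)) ℝ (Fin d → ℝ))
    (σ : Fin (d + 1) → Bool) :
    halfOpenSimplex B σ =ᵐ[volume] halfOpenSimplex B fun _ => true := by
  filter_upwards [ae_coord_ne_zero hd B] with x hx
  refine propext ⟨fun h => halfOpenSimplex_subset B σ h, fun h i => ?_⟩
  have : 0 < B.coord i x := lt_of_le_of_ne (h i) (hx i).symm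
  cases σ i
  · exact this
  · exact this.le

/-- The facets of the simplex `B` containing a point that enter the simplex in direction `-y`. -/
noncomputable def signPattern (B : AffineBasis (Fin (d + 1)) ℝ (Fin d → ℝ)) (y : Fin d → ℝ) :
    Fin (d + 1) → Bool :=
  fun i => decide ((B.coord i).linear y < 0)

/-- The proportion of directions in the unit ball with a given sign pattern. -/
noncomputable def patternWeight (B : AffineBasis (Fin (d + 1)) ℝ (Fin d → ℝ))
    (σ : Fin (d + 1) → Bool) : ℝ :=
  (volume (eball d)).toReal⁻¹ * volume.real (eball d ∩ {y | signPattern B y = σ})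

lemma measurableSet_signPattern_eq (B : AffineBasis (Fin (d + 1)) ℝ (Fin d → ℝ))
    (σ : Fin (d + 1) → Bool) : MeasurableSet {y | signPattern B y = σ} := by
  simp only [funext_iff, Set.ofPred_forall]
  refine MeasurableSet.iInter fun i => ?_
  have h : MeasurableSet {y | (B.coord i).linear y < 0} :=
    (isOpen_lt (B.coord i).linear.continuous_of_finiteDimensional continuous_const).measurableSet
  cases hσ : σ i
  · simpa [signPattern, Set.compl_def] using h.compl
  · simpa [signPattern] using h

lemma sum_patternWeight (B : AffineBasis (Fin (d + 1)) ℝ (Fin d → ℝ)) :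
    ∑ σ, patternWeight B σ = 1 := by
  have h : ∑ σ, volume.real (eball d ∩ {y | signPattern B y = σ}) = volume.real (eball d) := by
    rw [← measureReal_iUnion_fintype (h' := fun σ =>
      ((measure_mono Set.inter_subset_left).trans_lt volume_eball_lt_top).ne)]
    · congr 1
      ext y
      simp
    · intro σ τ hστ
      refine Set.disjoint_left.2 fun y hy hy' => hστ ?_
      exact hy.2.symm.trans hy'.2
    · exact fun σ => measurableSet_euclideanBall.inter (measurableSet_signPattern_eq B σ)
  simp only [patternWeight, ← Finset.mul_sum, h]
  exact inv_mul_cancel₀ volume_real_eball_pos.ne'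

lemma patternWeight_not (hd : 1 ≤ d) (B : AffineBasis (Fin (d + 1)) ℝ (Fin d → ℝ))
    (σ : Fin (d + 1) → Bool) : patternWeight B (fun i => !σ i) = patternWeight B σ := by
  unfold patternWeight
  congr 1
  rw [measureReal_def, measureReal_def,
    ← Measure.measure_neg volume (eball d ∩ {y | signPattern B y = σ})]
  congr 1
  refine measure_congr ?_
  filter_upwards [ae_linear_coord_ne_zero hd B] with y hy
  refine propext (and_congr ?_ ?_)
  · simp [eball]
  · change signPattern B y = _ ↔ signPattern B (-y) = σ
    simp only [funext_iff]
    refine forall_congr' fun i => ?_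
    simp only [signPattern, map_neg, neg_lt_zero]
    rcases (hy i).lt_or_gt with h | h <;> cases σ i <;> simp only [h, h.not_gt] <;> decide

lemma eventually_sub_smul_mem_halfOpenSimplex_iff
    (B : AffineBasis (Fin (d + 1)) ℝ (Fin d → ℝ)) (x : Fin d → ℝ) {y : Fin d → ℝ}
    (hy : ∀ i, (B.coord i).linear y ≠ 0) :
    ∀ᶠ ε in 𝓝[>] (0 : ℝ), (x - ε • y ∈ halfOpenSimplex B (fun _ => true) ↔
      x ∈ halfOpenSimplex B (signPattern B y)) := by
  have hi : ∀ i, ∀ᶠ ε in 𝓝[>] (0 : ℝ),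
      (B.coord i (x - ε • y) ∈ halfLine true ↔ B.coord i x ∈ halfLine (signPattern B y i)) := by
    intro i
    have hcoord : ∀ ε : ℝ, B.coord i (x - ε • y) = B.coord i x - ε * (B.coord i).linear y := by
      intro ε
      have := (B.coord i).map_vadd x (-(ε • y))
      rw [vadd_eq_add, neg_add_eq_sub] at this
      rw [this]
      rw [map_neg, map_smul, vadd_eq_add, smul_eq_mul, neg_add_eq_sub]
    have hlim : Tendsto (fun ε : ℝ => B.coord i (x - ε • y)) (𝓝[>] 0) (𝓝 (B.coord i x)) := by
      simp only [hcoord]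
      have : Continuous fun ε : ℝ => B.coord i x - ε * (B.coord i).linear y := by fun_prop
      simpa using (this.tendsto 0).mono_left nhdsWithin_le_nhds
    rcases lt_trichotomy (B.coord i x) 0 with h | h | h
    · filter_upwards [hlim.eventually_lt_const h] with ε hε
      refine iff_of_false (not_le.2 hε) ?_
      cases signPattern B y i
      · exact not_lt.2 h.le
      · exact not_le.2 h
    · filter_upwards [self_mem_nhdsWithin] with ε hε
      rw [hcoord, h, zero_sub]
      rcases (hy i).lt_or_gt with hl | hl
      · have : ε * (B.coord i).linear y < 0 := mul_neg_of_pos_of_neg hε hl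
        simp only [signPattern, hl, halfLine, Set.mem_Ici, decide_true, if_true, neg_nonneg, this.le,
          le_refl]
      · have : 0 < ε * (B.coord i).linear y := mul_pos hε hl
        simp only [signPattern, hl.not_gt, halfLine, Set.mem_Ici, Set.mem_Ioi, decide_false, if_true,
          Bool.false_eq_true, if_false, neg_nonneg, this.not_ge, lt_irrefl]
    · filter_upwards [hlim.eventually_const_lt h] with ε hε
      refine iff_of_true hε.le ?_
      cases signPattern B y i
      · exact h
      · exact h.le
  filter_upwards [eventually_all.2 hi] with ε hε
  exact forall_congr' hε

lemma tendsto_solidAngle_simplex (hd : 1 ≤ d) (B : AffineBasis (Fin (d + 1)) ℝ (Fin d → ℝ))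
    (x : Fin d → ℝ) :
    Tendsto (fun ε : ℝ => (volume (eball d)).toReal⁻¹ * ∫ y in eball d,
        (halfOpenSimplex B fun _ => true).indicator (fun _ => (1 : ℝ)) (x - ε • y))
      (𝓝[>] 0)
      (𝓝 (∑ σ, patternWeight B σ * (halfOpenSimplex B σ).indicator (fun _ => (1 : ℝ)) x)) := by
  have hfin : IsFiniteMeasure (volume.restrict (eball d)) :=
    ⟨by simpa using volume_eball_lt_top⟩
  have hlim : ∑ σ, patternWeight B σ * (halfOpenSimplex B σ).indicator (fun _ => (1 : ℝ)) x =
      (volume (eball d)).toReal⁻¹ * ∫ y in eball d,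
        (halfOpenSimplex B (signPattern B y)).indicator (fun _ => (1 : ℝ)) x := by
    have hsplit : ∀ y, (halfOpenSimplex B (signPattern B y)).indicator (fun _ => (1 : ℝ)) x =
        ∑ σ, {y | signPattern B y = σ}.indicator (fun _ => (1 : ℝ)) y *
          (halfOpenSimplex B σ).indicator (fun _ => (1 : ℝ)) x := by
      intro y
      rw [Finset.sum_eq_single (signPattern B y)]
      · simp
      · intro σ _ hσ
        simp [hσ.symm]
      · simp
    simp only [hsplit]
    rw [integral_finsetSum]
    · rw [Finset.mul_sum]
      refine Finset.sum_congr rfl fun σ _ => ?_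
      rw [integral_mul_const, setIntegral_indicator (measurableSet_signPattern_eq B σ),
        setIntegral_const, patternWeight, smul_eq_mul]
      ring
    · exact fun σ _ => ((integrable_const _).indicator (measurableSet_signPattern_eq B σ)).mul_const _
  rw [hlim]
  refine Tendsto.const_mul _ (tendsto_integral_filter_of_dominated_convergence (fun _ => 1)
    (Eventually.of_forall fun ε => ?_) (Eventually.of_forall fun ε => ae_of_all _ fun y => ?_)
    (integrable_const _) ?_)
  · exact ((measurable_const.indicator (measurableSet_halfOpenSimplex B _)).comp
      (by fun_prop)).aestronglyMeasurable
  · exact (norm_indicator_le_norm_self _ _).trans (by simp)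
  · filter_upwards [ae_restrict_of_ae (ae_linear_coord_ne_zero hd B)] with y hy
    refine tendsto_const_nhds.congr' ?_
    filter_upwards [eventually_sub_smul_mem_halfOpenSimplex_iff B x hy] with ε hε
    by_cases h : x ∈ halfOpenSimplex B (signPattern B y)
    · rw [Set.indicator_of_mem h, Set.indicator_of_mem (hε.2 h)]
    · rw [Set.indicator_of_notMem h, Set.indicator_of_notMem (mt hε.1 h)]

end SolidAngle

section Complex

open scoped Function

variable {d : ℕ} {κ : Type*} [Fintype κ]

/-- The closed simplex with vertices `B`. -/
abbrev closedSimplex (B : AffineBasis (Fin (d + 1)) ℝ (Fin d → ℝ)) : Set (Fin d → ℝ) :=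
  halfOpenSimplex B fun _ => true

lemma ae_indicator_iUnion_eq_sum {α : Type*} [MeasurableSpace α] {μ : Measure α} {s : κ → Set α}
    (hs : Pairwise (AEDisjoint μ on s)) :
    ∀ᵐ z ∂μ, (⋃ k, s k).indicator (fun _ => (1 : ℝ)) z =
      ∑ k, (s k).indicator (fun _ => (1 : ℝ)) z := by
  have h : ∀ᵐ z ∂μ, ∀ k l, k ≠ l → ¬(z ∈ s k ∧ z ∈ s l) :=
    ae_all_iff.2 fun k => ae_all_iff.2 fun l => by
      by_cases hkl : k = l
      · simp [hkl]
      · have := measure_eq_zero_iff_ae_notMem.1 (hs hkl)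
        filter_upwards [this] with z hz _ using hz
  filter_upwards [h] with z hz
  by_cases hex : ∃ k, z ∈ s k
  · obtain ⟨k, hk⟩ := hex
    rw [Set.indicator_of_mem (Set.mem_iUnion.2 ⟨k, hk⟩), Finset.sum_eq_single k]
    · rw [Set.indicator_of_mem hk]
    · exact fun l _ hl => Set.indicator_of_notMem (fun hl' => hz l k hl ⟨hl', hk⟩) _
    · simp
  · rw [Set.indicator_of_notMem (by simpa using hex), Finset.sum_eq_zero]
    exact fun k _ => Set.indicator_of_notMem (fun hk => hex ⟨k, hk⟩) _

lemma ae_comp_sub_smul {p : (Fin d → ℝ) → Prop} (hp : ∀ᵐ z, p z) (x : Fin d → ℝ) {ε : ℝ}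
    (hε : ε ≠ 0) : ∀ᵐ y : Fin d → ℝ, p (x - ε • y) := by
  have h : ∀ᵐ z : Fin d → ℝ, p (x - z) :=
    (Measure.measurePreserving_sub_left volume x).quasiMeasurePreserving.ae hp
  rw [ae_iff] at h ⊢
  have := Measure.addHaar_preimage_smul volume hε {z | ¬p (x - z)}
  rw [h, mul_zero] at this
  exact this

lemma solidAngle_iUnion_closedSimplex (hd : 1 ≤ d)
    (B : κ → AffineBasis (Fin (d + 1)) ℝ (Fin d → ℝ))
    (hB : Pairwise (AEDisjoint volume on fun k => closedSimplex (B k))) (x : Fin d → ℝ) :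
    solidAngle d (⋃ k, closedSimplex (B k)) x =
      ∑ k, ∑ σ, patternWeight (B k) σ *
        (halfOpenSimplex (B k) σ).indicator (fun _ => (1 : ℝ)) x := by
  refine Tendsto.limUnder_eq ((tendsto_finsetSum Finset.univ fun k _ =>
    tendsto_solidAngle_simplex hd (B k) x).congr' ?_)
  have hfin : IsFiniteMeasure (volume.restrict (eball d)) :=
    ⟨by simpa using volume_eball_lt_top⟩
  filter_upwards [self_mem_nhdsWithin] with ε hε
  rw [← Finset.mul_sum, ← integral_finsetSum]
  · congr 1
    refine integral_congr_ae (ae_restrict_of_ae ?_)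
    filter_upwards [ae_comp_sub_smul (ae_indicator_iUnion_eq_sum hB) x (ne_of_gt hε)] with y hy
    exact hy.symm
  · intro k _
    refine (integrable_const (1 : ℝ)).mono ?_ (ae_of_all _ fun y => ?_)
    · exact ((measurable_const.indicator (measurableSet_halfOpenSimplex (B k) _)).comp
        (by fun_prop)).aestronglyMeasurable
    · exact norm_indicator_le_norm_self _ _

lemma SN_iUnion_closedSimplex (hd : 1 ≤ d)
    (B : κ → AffineBasis (Fin (d + 1)) ℝ (Fin d → ℝ))
    (hB : Pairwise (AEDisjoint volume on fun k => closedSimplex (B k)))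
    {f g : (Fin d → ℝ) → ℝ} (hfg : Set.EqOn f g (⋃ k, closedSimplex (B k)))
    {N : ℕ} (hN : 0 < N) :
    SN d N f (⋃ k, closedSimplex (B k)) =
      ∑ k, ∑ σ, patternWeight (B k) σ * latticeSum ((halfOpenSimplex (B k) σ).indicator g) N := by
  have hbdd : Bornology.IsBounded (⋃ k, closedSimplex (B k)) :=
    Bornology.isBounded_iUnion.2 fun k => isBounded_halfOpenSimplex (B k) _
  have hsub : ∀ k σ, halfOpenSimplex (B k) σ ⊆ ⋃ k, closedSimplex (B k) := fun k σ =>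
    (halfOpenSimplex_subset (B k) σ).trans (Set.subset_iUnion (fun k => closedSimplex (B k)) k)
  rw [← Fintype.sum_prod_type', ← latticeSum_finsetSum Finset.univ hbdd
    (fun kσ x hx => Set.indicator_of_notMem (fun h => hx (hsub kσ.1 kσ.2 h)) g) _ hN,
    SN, latticeSum, zpow_neg, zpow_natCast]
  congr 1
  refine tsum_congr fun n => ?_
  have hn : (fun i => (n i : ℝ) / N) = (N : ℝ)⁻¹ • intVec n := by
    funext i
    simp [intVec, div_eq_inv_mul]
  rw [hn, solidAngle_iUnion_closedSimplex hd B hB, ← Fintype.sum_prod_type', Finset.sum_mul]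
  refine Finset.sum_congr rfl fun kσ _ => ?_
  rw [mul_assoc]
  congr 1
  by_cases hx : (N : ℝ)⁻¹ • intVec n ∈ halfOpenSimplex (B kσ.1) kσ.2
  · rw [Set.indicator_of_mem hx, Set.indicator_of_mem hx, one_mul, hfg (hsub _ _ hx)]
  · rw [Set.indicator_of_notMem hx, Set.indicator_of_notMem hx, zero_mul]

lemma exists_contDiff_hasCompactSupport_eqOn {n : ℕ} {f : (Fin d → ℝ) → ℝ} (hf : ContDiff ℝ n f)
    {s : Set (Fin d → ℝ)} (hs : Bornology.IsBounded s) :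
    ∃ g : (Fin d → ℝ) → ℝ, ContDiff ℝ n g ∧ HasCompactSupport g ∧ Set.EqOn f g s := by
  obtain ⟨r, hr0, hr⟩ := hs.subset_closedBall_lt 0 0
  let b : ContDiffBump (0 : Fin d → ℝ) := ⟨r, r + 1, hr0, by linarith⟩
  refine ⟨fun x => b x * f x, b.contDiff.mul hf, b.hasCompactSupport.mul_right, fun x hx => ?_⟩
  simp [b.one_of_mem_closedBall (hr hx)]

theorem hasEvenExpansion_SN (hd : 1 ≤ d)
    (B : κ → AffineBasis (Fin (d + 1)) ℝ (Fin d → ℝ))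
    (hB : Pairwise (AEDisjoint volume on fun k => closedSimplex (B k)))
    (hint : ∀ k i, ∃ z : Fin d → ℤ, B k i = intVec z)
    (w : ℕ) {f : (Fin d → ℝ) → ℝ} (hf : ContDiff ℝ (w + 1 : ℕ) f) :
    HasEvenExpansion w fun N => SN d N f (⋃ k, closedSimplex (B k)) := by
  obtain ⟨g, hg, hsupp, hfg⟩ := exists_contDiff_hasCompactSupport_eqOn hf
    (Bornology.isBounded_iUnion.2 fun k => isBounded_halfOpenSimplex (B k) fun _ => true)
  refine (HasEvenExpansion.sum Finset.univ fun k _ => HasEvenExpansion.sum Finset.univ fun σ _ =>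
    (hasEvenExpansion_halfOpenSimplex (B k) (hint k) σ w hg hsupp).const_mul
      (patternWeight (B k) σ / 2)).congr fun N hN => ?_
  rw [SN_iUnion_closedSimplex hd B hB hfg hN]
  refine Finset.sum_congr rfl fun k _ => ?_
  have hnot : Function.Involutive fun (σ : Fin (d + 1) → Bool) i => !σ i := fun σ => by simp
  have h := Equiv.sum_comp hnot.toPerm fun σ => patternWeight (B k) σ *
    latticeSum ((halfOpenSimplex (B k) σ).indicator g) N
  simp only [Function.Involutive.coe_toPerm, patternWeight_not hd] at h
  simp only [mul_add, Finset.sum_add_distrib, div_mul_eq_mul_div, ← Finset.sum_div, h]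
  ring

theorem tendsto_SN (hd : 1 ≤ d) (B : κ → AffineBasis (Fin (d + 1)) ℝ (Fin d → ℝ))
    (hB : Pairwise (AEDisjoint volume on fun k => closedSimplex (B k)))
    {f : (Fin d → ℝ) → ℝ} (hf : Continuous f) :
    Tendsto (fun N => SN d N f (⋃ k, closedSimplex (B k))) atTop
      (𝓝 (∫ x in ⋃ k, closedSimplex (B k), f x)) := by
  have hbdd : Bornology.IsBounded (⋃ k, closedSimplex (B k)) :=
    Bornology.isBounded_iUnion.2 fun k => isBounded_halfOpenSimplex (B k) _
  have hlim : ∫ x in ⋃ k, closedSimplex (B k), f x =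
      ∑ k, ∑ σ, patternWeight (B k) σ * ∫ x in halfOpenSimplex (B k) σ, f x := by
    rw [integral_iUnion_ae (fun k => (measurableSet_halfOpenSimplex (B k) _).nullMeasurableSet) hB
      ((hf.continuousOn.integrableOn_compact hbdd.isCompact_closure).mono_set subset_closure),
      tsum_fintype]
    refine Finset.sum_congr rfl fun k _ => ?_
    simp only [setIntegral_congr_set (halfOpenSimplex_ae_eq hd (B k) _), ← Finset.sum_mul,
      sum_patternWeight, one_mul]
  rw [hlim]
  refine (tendsto_finsetSum Finset.univ fun k _ => tendsto_finsetSum Finset.univ fun σ _ =>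
    (tendsto_latticeSum_indicator hf (isBounded_halfOpenSimplex (B k) σ)
      (measurableSet_halfOpenSimplex (B k) σ)
      ((convex_halfOpenSimplex (B k) σ).addHaar_frontier volume)).const_mul
      (patternWeight (B k) σ)).congr' ?_
  filter_upwards [eventually_gt_atTop 0] with N hN
  exact (SN_iUnion_closedSimplex hd B hB (fun _ _ => rfl) hN).symm

lemma exists_affineBasis_range_eq {t : Finset (Fin d → ℝ)}
    (ht : AffineIndependent ℝ ((↑) : t → Fin d → ℝ)) (hcard : t.card = d + 1) :
    ∃ B : AffineBasis (Fin (d + 1)) ℝ (Fin d → ℝ), Set.range B = t := by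
  let e : Fin (d + 1) ≃ t := (t.equivFinOfCardEq hcard).symm
  have hind : AffineIndependent ℝ fun i => (e i : Fin d → ℝ) :=
    (affineIndependent_equiv e (p := fun x : t => (x : Fin d → ℝ))).2 ht
  have htop := hind.affineSpan_eq_top_iff_card_eq_finrank_add_one.2 (by simp)
  refine ⟨⟨fun i => (e i : Fin d → ℝ), hind, htop⟩, ?_⟩
  ext x
  constructor
  · rintro ⟨i, rfl⟩
    exact (e i).2
  · intro hx
    exact ⟨e.symm ⟨x, hx⟩, congrArg Subtype.val (e.apply_symm_apply ⟨x, hx⟩)⟩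

lemma aedisjoint_convexHull (hd : 1 ≤ d) (K : Geometry.SimplicialComplex ℝ (Fin d → ℝ))
    {s t : Finset (Fin d → ℝ)} (hs : s ∈ K.faces) (ht : t ∈ K.faces) (hscard : s.card = d + 1)
    (htcard : t.card = d + 1) (hst : s ≠ t) :
    AEDisjoint volume (convexHull ℝ (s : Set (Fin d → ℝ))) (convexHull ℝ (t : Set (Fin d → ℝ))) := by
  obtain ⟨B, hB⟩ := exists_affineBasis_range_eq (K.indep hs) hscard
  obtain ⟨p, hps, hpt⟩ : ∃ p ∈ s, p ∉ t := Finset.not_subset.1 fun h =>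
    hst (Finset.eq_of_subset_of_card_le h (by omega))
  obtain ⟨i, hi⟩ : p ∈ Set.range B := hB ▸ hps
  have hsub : convexHull ℝ (s ∩ t : Set (Fin d → ℝ)) ⊆ B.coord i ⁻¹' {0} := by
    refine convexHull_min ?_ ((convex_singleton 0).affine_preimage (B.coord i))
    rintro x ⟨hxs, hxt⟩
    obtain ⟨j, rfl⟩ : x ∈ Set.range B := hB ▸ hxs
    refine B.coord_apply_ne fun hij => hpt ?_
    rw [← hi, hij]
    exact hxt
  refine measure_mono_null ((K.inter_subset_convexHull hs ht).trans hsub) ?_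
  rw [measure_eq_zero_iff_ae_notMem]
  filter_upwards [ae_coord_ne_zero hd B] with x hx using hx i

end Complex

section Richardson

lemma HasEvenExpansion.exists_abs_sub_le {w : ℕ} {S : ℕ → ℝ} (hS : HasEvenExpansion w S) {I : ℝ}
    (hI : Tendsto S atTop (𝓝 I)) {c : ℕ → ℝ} (hc0 : ∑ j ∈ Finset.range (w / 2 + 1), c j = 1)
    (hck : ∀ k ∈ Finset.Icc 1 (w / 2),
      ∑ j ∈ Finset.range (w / 2 + 1), ((2 : ℝ) ^ (-(2 * k : ℤ))) ^ j * c j = 0) :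
    ∃ C : ℝ, ∀ N : ℕ, 0 < N →
      |I - ∑ j ∈ Finset.range (w / 2 + 1), c j * S (2 ^ j * N)| ≤ C * (N : ℝ) ^ (-(w : ℤ) - 1) := by
  obtain ⟨a, C, h⟩ := hS
  have hinv : Tendsto (fun N : ℕ => (N : ℝ)⁻¹) atTop (𝓝 0) := tendsto_inv_atTop_nhds_zero_nat
  have hpoly : Tendsto (fun N : ℕ => ∑ k ∈ Finset.range (w / 2 + 1), a k * (N : ℝ)⁻¹ ^ (2 * k))
      atTop (𝓝 (a 0)) := by
    have := tendsto_finsetSum (Finset.range (w / 2 + 1)) fun k _ =>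
      (hinv.pow (2 * k)).const_mul (a k)
    rw [Finset.sum_range_succ'] at this
    simpa using this
  have hdiff : Tendsto (fun N : ℕ =>
      S N - ∑ k ∈ Finset.range (w / 2 + 1), a k * (N : ℝ)⁻¹ ^ (2 * k)) atTop (𝓝 0) := by
    have hpow := (hinv.pow (w + 1)).const_mul C
    rw [zero_pow w.succ_ne_zero, mul_zero] at hpow
    refine squeeze_zero_norm' ?_ hpow
    filter_upwards [eventually_gt_atTop 0] with N hN using h N hN
  have ha : a 0 = I := by
    have := hI.sub hdiff
    simp only [sub_sub_cancel, sub_zero] at this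
    exact tendsto_nhds_unique hpoly this
  have hsum : ∀ N : ℕ, ∀ k ∈ Finset.range (w / 2 + 1),
      ∑ j ∈ Finset.range (w / 2 + 1), c j * (a k * ((2 ^ j * N : ℕ) : ℝ)⁻¹ ^ (2 * k)) =
        if k = 0 then I else 0 := by
    intro N k hk
    split_ifs with hk0
    · simp [hk0, ← Finset.sum_mul, hc0, ha]
    · have := hck k (Finset.mem_Icc.2 ⟨Nat.one_le_iff_ne_zero.2 hk0,
        Nat.lt_succ_iff.1 (Finset.mem_range.1 hk)⟩)
      rw [← mul_zero (a k * (N : ℝ)⁻¹ ^ (2 * k)), ← this, Finset.mul_sum]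
      refine Finset.sum_congr rfl fun j _ => ?_
      have h2 : ((2 : ℝ) ^ (-(2 * k : ℤ))) ^ j = ((2 : ℝ) ^ j)⁻¹ ^ (2 * k) := by
        rw [zpow_neg, inv_pow, inv_pow, ← pow_mul, mul_comm j, pow_mul]
        norm_cast
      rw [h2]
      push_cast
      rw [mul_inv, mul_pow]
      ring
  refine ⟨∑ j ∈ Finset.range (w / 2 + 1), |c j| * (C * ((2 : ℝ) ^ j)⁻¹ ^ (w + 1)), fun N hN => ?_⟩
  have hI' : I = ∑ j ∈ Finset.range (w / 2 + 1), c j *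
      ∑ k ∈ Finset.range (w / 2 + 1), a k * ((2 ^ j * N : ℕ) : ℝ)⁻¹ ^ (2 * k) := by
    simp only [Finset.mul_sum]
    rw [Finset.sum_comm, Finset.sum_congr rfl (hsum N)]
    simp
  have hzpow : (N : ℝ) ^ (-(w : ℤ) - 1) = (N : ℝ)⁻¹ ^ (w + 1) := by
    rw [← neg_add', zpow_neg, inv_pow]
    norm_cast
  rw [hzpow, hI', ← Finset.sum_sub_distrib, Finset.sum_mul]
  refine (Finset.abs_sum_le_sum_abs _ _).trans (Finset.sum_le_sum fun j _ => ?_)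
  rw [← mul_sub, abs_mul, abs_sub_comm, mul_assoc, mul_assoc, ← mul_pow, ← mul_inv]
  gcongr
  exact_mod_cast h (2 ^ j * N) (by positivity)

end Richardson

theorem stmt19 (d : ℕ) (hd : 1 ≤ d)
    (K : Geometry.SimplicialComplex ℝ (Fin d → ℝ))
    (hfin : K.faces.Finite)
    (hint : ∀ s ∈ K.faces, ∀ p ∈ s, ∀ i : Fin d, ∃ z : ℤ, p i = (z : ℝ))
    (hhom : ∀ s ∈ K.faces, ∃ t ∈ K.faces, s ⊆ t ∧ t.card = d + 1)
    (w : ℕ) (f : (Fin d → ℝ) → ℝ) (hf : ContDiff ℝ (w + 1) f)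
    (c : ℕ → ℝ)
    -- `(c_j)` solves the Vandermonde system `Σ_j (2^{-2k})^j c_j = δ_{k,0}`, `0 ≤ k ≤ ⌊w/2⌋`
    (hc0 : ∑ j ∈ Finset.range (w / 2 + 1), c j = 1)
    (hck : ∀ k ∈ Finset.Icc 1 (w / 2),
      ∑ j ∈ Finset.range (w / 2 + 1), ((2 : ℝ) ^ (-(2 * k : ℤ))) ^ j * c j = 0) :
    ∃ C : ℝ, ∀ N : ℕ, 0 < N →
      |(∫ x in K.space, f x)
          - ∑ j ∈ Finset.range (w / 2 + 1), c j * SN d (2 ^ j * N) f K.space|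
        ≤ C * (N : ℝ) ^ (-(w : ℤ) - 1) := by
  have hfin' : {t | t ∈ K.faces ∧ t.card = d + 1}.Finite := hfin.subset fun t ht => ht.1
  let _ : Fintype {t | t ∈ K.faces ∧ t.card = d + 1} := hfin'.fintype
  choose B hB using fun t : {t | t ∈ K.faces ∧ t.card = d + 1} =>
    exists_affineBasis_range_eq (K.indep t.2.1) t.2.2
  have hull : ∀ t, closedSimplex (B t) = convexHull ℝ (t.1 : Set (Fin d → ℝ)) := fun t => by
    rw [← hB t, convexHull_eq_halfOpenSimplex]
  have hspace : K.space = ⋃ t, closedSimplex (B t) := by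
    ext x
    simp only [Geometry.SimplicialComplex.mem_space_iff, Set.mem_iUnion, hull]
    constructor
    · rintro ⟨s, hs, hx⟩
      obtain ⟨t, ht, hst, hcard⟩ := hhom s hs
      exact ⟨⟨t, ht, hcard⟩, convexHull_mono (Finset.coe_subset.2 hst) hx⟩
    · rintro ⟨t, hx⟩
      exact ⟨t.1, t.2.1, hx⟩
  have hdisj : Pairwise fun s t => AEDisjoint volume (closedSimplex (B s)) (closedSimplex (B t)) := by
    intro s t hst
    rw [hull, hull]
    exact aedisjoint_convexHull hd K s.2.1 t.2.1 s.2.2 t.2.2 fun h => hst (Subtype.ext h)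
  have hvert : ∀ t i, ∃ z : Fin d → ℤ, B t i = intVec z := by
    intro t i
    have hmem : B t i ∈ (t.1 : Set (Fin d → ℝ)) := hB t ▸ Set.mem_range_self i
    choose z hz using hint t.1 t.2.1 _ hmem
    exact ⟨z, funext hz⟩
  rw [hspace]
  exact (hasEvenExpansion_SN hd B hdisj hvert w (by exact_mod_cast hf)).exists_abs_sub_le
    (tendsto_SN hd B hdisj hf.continuous) hc0 hck
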